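/- arXiv:2207.09921 — 4 statements merged into one kernel-verified Lean document; each statement's English description precedes it below -/
import Mathlib

section
/- Let σ1, σ2 > 0, ρ ∈ (−1,1), and let α1, α2 be real numbers such that either −1 < α1 < 0 and −1 < α2 < 0, or 0 < α1 ≤ 2 and 0 < α2 ≤ 2, or α1 > 2 and α2 > 2. Then E[|X1|^{α1}|X2|^{α2}] − E[|X1|^{α1}]·E[|X2|^{α2}] ≥ (2^{(α1+α2)/2} α1 α2 σ1^{α1} σ2^{α2} ρ² / (2π)) · Γ((α1+1)/2) · Γ((α2+1)/2). -/
open MeasureTheory Real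

/-- Centered bivariate Gaussian density with variances σ₁², σ₂² and correlation ρ. -/
noncomputable def gaussDensity2 (σ₁ σ₂ ρ x y : ℝ) : ℝ :=
  (2 * π * σ₁ * σ₂ * Real.sqrt (1 - ρ ^ 2))⁻¹ *
    Real.exp (-(x ^ 2 / σ₁ ^ 2 - 2 * ρ * x * y / (σ₁ * σ₂) + y ^ 2 / σ₂ ^ 2) /
      (2 * (1 - ρ ^ 2)))

/-- E[|X₁|^a |X₂|^b] for the centered bivariate Gaussian. -/
noncomputable def E2 (σ₁ σ₂ ρ a b : ℝ) : ℝ :=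
  ∫ q : ℝ × ℝ, |q.1| ^ a * |q.2| ^ b * gaussDensity2 σ₁ σ₂ ρ q.1 q.2

/-- E[|X|^a] for a centered Gaussian with variance σ². -/
noncomputable def E1 (σ a : ℝ) : ℝ :=
  ∫ x : ℝ, |x| ^ a * (Real.sqrt (2 * π * σ ^ 2))⁻¹ * Real.exp (-x ^ 2 / (2 * σ ^ 2))

open Filter Topology Finset

/-- The `n`-th Taylor coefficient of the hypergeometric function `₂F₁(A, B; C; z)`. -/
noncomputable def hypCoeff (A B C : ℝ) (n : ℕ) : ℝ :=
  ∏ i ∈ range n, (A + i) * (B + i) / ((C + i) * (i + 1))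

/-- The hypergeometric function `₂F₁(A, B; C; z)` as a real power series. -/
noncomputable def hypF (A B C z : ℝ) : ℝ := ∑' n, hypCoeff A B C n * z ^ n

lemma hypCoeff_zero (A B C : ℝ) : hypCoeff A B C 0 = 1 := by simp [hypCoeff]

lemma hypCoeff_succ (A B C : ℝ) (n : ℕ) :
    hypCoeff A B C (n + 1) = hypCoeff A B C n * ((A + n) * (B + n) / ((C + n) * (n + 1))) := by
  rw [hypCoeff, prod_range_succ, ← hypCoeff]

lemma hypCoeff_pos {A B C : ℝ} (hA : 0 < A) (hB : 0 < B) (hC : 0 < C) (n : ℕ) :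
    0 < hypCoeff A B C n := by
  unfold hypCoeff
  positivity

lemma hypCoeff_param_succ {A B C : ℝ} (hC : 0 < C) (n : ℕ) :
    hypCoeff A B (C + 1) n = hypCoeff A B C n * (C / (C + n)) := by
  induction n with
  | zero => simp [hypCoeff_zero, hC.ne']
  | succ n ih =>
    rw [hypCoeff_succ, hypCoeff_succ, ih]
    push_cast
    have h₁ : C + n ≠ 0 := by positivity
    have h₂ : C + 1 + n ≠ 0 := by positivity
    have h₃ : C + (n + 1) ≠ 0 := by positivity
    field_simp
    ring

lemma hypF_zero (A B C : ℝ) : hypF A B C 0 = 1 := by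
  rw [hypF, tsum_eq_single 0 (fun n hn => by simp [hn])]
  simp [hypCoeff_zero]

lemma hypF_nonneg {A B C z : ℝ} (hA : 0 < A) (hB : 0 < B) (hC : 0 < C) (hz : 0 ≤ z) :
    0 ≤ hypF A B C z :=
  tsum_nonneg fun n => mul_nonneg (hypCoeff_pos hA hB hC n).le (pow_nonneg hz n)

lemma summable_nat_mul_hypCoeff_mul_pow_of_pos {A B C r : ℝ} (hA : 0 < A) (hB : 0 < B)
    (hC : 0 < C) (hr : 0 < r) (hr1 : r < 1) :
    Summable fun n : ℕ => n * hypCoeff A B C n * r ^ n := by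
  have hpos : ∀ n : ℕ, 0 < n → 0 < n * hypCoeff A B C n * r ^ n := fun n hn => by
    have := hypCoeff_pos hA hB hC n
    positivity
  refine summable_of_ratio_test_tendsto_lt_one hr1 ?_ ?_
  · filter_upwards [eventually_gt_atTop 0] with n hn using (hpos n hn).ne'
  · have h₁ := tendsto_add_mul_div_add_mul_atTop_nhds (𝕜 := ℝ) A C 1 one_ne_zero
    have h₂ := tendsto_add_mul_div_add_mul_atTop_nhds (𝕜 := ℝ) B 0 1 one_ne_zero
    have h := (h₁.mul h₂).mul_const r
    rw [show (1 : ℝ) / 1 * (1 / 1) * r = r by ring] at h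
    refine h.congr' ?_
    filter_upwards [eventually_gt_atTop 0] with n hn
    rw [Real.norm_of_nonneg (hpos _ n.succ_pos).le, Real.norm_of_nonneg (hpos n hn).le,
      hypCoeff_succ]
    have := hypCoeff_pos hA hB hC n
    have hC' : C + n ≠ 0 := by positivity
    have hn' : (n : ℝ) ≠ 0 := by positivity
    push_cast
    rw [pow_succ]
    field_simp
    ring

lemma summable_nat_mul_hypCoeff_mul_pow {A B C z : ℝ} (hA : 0 < A) (hB : 0 < B)
    (hC : 0 < C) (hz : |z| < 1) : Summable fun n : ℕ => n * hypCoeff A B C n * z ^ n := by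
  obtain ⟨r, hzr, hr1⟩ := exists_between hz
  have hr : 0 < r := (abs_nonneg z).trans_lt hzr
  refine (summable_nat_mul_hypCoeff_mul_pow_of_pos hA hB hC hr hr1).of_norm_bounded fun n => ?_
  have := hypCoeff_pos hA hB hC n
  rw [norm_mul, norm_pow, Real.norm_of_nonneg (by positivity), Real.norm_eq_abs]
  gcongr

lemma summable_hypCoeff_mul_pow {A B C z : ℝ} (hA : 0 < A) (hB : 0 < B)
    (hC : 0 < C) (hz : |z| < 1) : Summable fun n : ℕ => hypCoeff A B C n * z ^ n := by
  refine (summable_nat_mul_hypCoeff_mul_pow hA hB hC hz).norm.of_norm_bounded_eventually_nat ?_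
  filter_upwards [eventually_gt_atTop 0] with n hn
  rw [mul_assoc, norm_mul (n : ℝ)]
  refine le_mul_of_one_le_left (norm_nonneg _) ?_
  rw [Real.norm_of_nonneg n.cast_nonneg]
  exact_mod_cast hn

lemma hasDerivAt_hypF {A B C z : ℝ} (hA : 0 < A) (hB : 0 < B) (hC : 0 < C) (hz : |z| < 1) :
    HasDerivAt (hypF A B C) (∑' n : ℕ, hypCoeff A B C n * (n * z ^ (n - 1))) z := by
  obtain ⟨r, hzr, hr1⟩ := exists_between hz
  have hr : 0 < r := (abs_nonneg z).trans_lt hzr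
  have hu := (summable_nat_mul_hypCoeff_mul_pow_of_pos hA hB hC hr hr1).mul_right r⁻¹
  refine hasDerivAt_tsum_of_isPreconnected
    (g := fun n z => hypCoeff A B C n * z ^ n)
    (g' := fun n z => hypCoeff A B C n * (n * z ^ (n - 1))) (t := Metric.ball 0 r) (y₀ := 0) hu Metric.isOpen_ball
    (convex_ball _ _).isPreconnected (fun n y _ => (hasDerivAt_pow n y).const_mul _)
    (fun n y hy => ?_) (by simpa using hr) (summable_hypCoeff_mul_pow hA hB hC (by simp))
    (by simpa using hzr)
  have hpos := hypCoeff_pos hA hB hC n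
  have hy' : |y| < r := by simpa using hy
  rcases n with _ | n
  · simp
  · rw [norm_mul, norm_mul, norm_pow, Real.norm_of_nonneg hpos.le,
      Real.norm_of_nonneg (Nat.cast_nonneg _), Real.norm_eq_abs, Nat.add_sub_cancel, pow_succ]
    calc hypCoeff A B C (n + 1) * (((n + 1 : ℕ) : ℝ) * |y| ^ n)
        ≤ hypCoeff A B C (n + 1) * (((n + 1 : ℕ) : ℝ) * r ^ n) := by gcongr
      _ = _ := by field_simp

lemma one_sub_mul_tsum_sub_hypF {A B C z : ℝ} (hA : 0 < A) (hB : 0 < B) (hC : 0 < C)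
    (hz : |z| < 1) :
    (1 - z) * ∑' n : ℕ, hypCoeff A B C n * (n * z ^ (n - 1)) - (A + B - C) * hypF A B C z =
      (C - A) * (C - B) / C * hypF A B (C + 1) z := by
  have hs := summable_nat_mul_hypCoeff_mul_pow hA hB hC hz
  have hF := summable_hypCoeff_mul_pow hA hB hC hz
  have hF1 := summable_hypCoeff_mul_pow hA hB (by positivity : 0 < C + 1) hz
  have hshift : ∀ n : ℕ, hypCoeff A B C (n + 1) * (((n + 1 : ℕ) : ℝ) * z ^ (n + 1 - 1)) =
      n * hypCoeff A B C n * z ^ n + ((A + B - C) * (hypCoeff A B C n * z ^ n) +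
        (C - A) * (C - B) / C * (hypCoeff A B (C + 1) n * z ^ n)) := fun n => by
    rw [hypCoeff_succ, hypCoeff_param_succ hC, Nat.add_sub_cancel]
    have : C + n ≠ 0 := by positivity
    push_cast
    field_simp
    ring
  have hsum := (hF.hasSum.mul_left (A + B - C)).add
    (hF1.hasSum.mul_left ((C - A) * (C - B) / C))
  have htot := hs.hasSum.add hsum
  have hD := (hasSum_nat_add_iff (f := fun n : ℕ => hypCoeff A B C n * (n * z ^ (n - 1))) 1).mp
    (htot.congr_fun hshift)
  have hzD : z * ∑' n : ℕ, hypCoeff A B C n * (n * z ^ (n - 1)) =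
      ∑' n : ℕ, n * hypCoeff A B C n * z ^ n := by
    rw [← tsum_mul_left]
    refine tsum_congr fun n => ?_
    rcases n with _ | n
    · simp
    · rw [Nat.add_sub_cancel, pow_succ]; ring
  rw [sub_mul, hzD, hD.tsum_eq, sum_range_one, Nat.cast_zero, hypF, hypF]
  ring

/-- Differentiating `(1 - z) ^ (A + B - C) * ₂F₁(A, B; C; z)` raises the parameter `C` by one. -/
lemma hasDerivAt_one_sub_rpow_mul_hypF {A B C z : ℝ} (hA : 0 < A) (hB : 0 < B) (hC : 0 < C)
    (hz : |z| < 1) :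
    HasDerivAt (fun z => (1 - z) ^ (A + B - C) * hypF A B C z)
      ((C - A) * (C - B) / C * ((1 - z) ^ (A + B - (C + 1)) * hypF A B (C + 1) z)) z := by
  have h1 : 0 < 1 - z := by linarith [(abs_lt.mp hz).2]
  have h := (((hasDerivAt_id z).const_sub 1).rpow_const (p := A + B - C) (Or.inl h1.ne')).mul
    (hasDerivAt_hypF hA hB hC hz)
  refine h.congr_deriv ?_
  have hp : (1 - z) ^ (A + B - C) = (1 - z) ^ (A + B - (C + 1)) * (1 - z) := by
    rw [← Real.rpow_add_one h1.ne']; congr 1; ring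
  have hq : A + B - C - 1 = A + B - (C + 1) := by ring
  simp only [id, hp, hq]
  linear_combination (1 - z) ^ (A + B - (C + 1)) * one_sub_mul_tsum_sub_hypF hA hB hC hz

/-- Under the sign condition `(1 - z) ^ (A + B - C) * ₂F₁(A, B; C; z)` is convex on `[0, 1)`, hence
lies above its tangent at `0`. -/
lemma one_add_mul_le_one_sub_rpow_mul_hypF {A B C z : ℝ} (hA : 0 < A) (hB : 0 < B) (hC : 0 < C)
    (hsign : 0 ≤ (C - A) * (C - B) * ((C + 1 - A) * (C + 1 - B))) (hz : 0 ≤ z) (hz1 : z < 1) :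
    1 + (C - A) * (C - B) / C * z ≤ (1 - z) ^ (A + B - C) * hypF A B C z := by
  have habs : ∀ w ∈ Set.Ico (0 : ℝ) 1, |w| < 1 := fun w hw => by
    rw [abs_of_nonneg hw.1]; exact hw.2
  have hz0 : z ∈ Set.Ico (0 : ℝ) 1 := ⟨hz, hz1⟩
  have h0 : (0 : ℝ) ∈ Set.Ico (0 : ℝ) 1 := by simp
  have hC1 : 0 < C + 1 := by positivity
  set l := (C - A) * (C - B) / C with hl
  have hd1 : ∀ w ∈ Set.Ico (0 : ℝ) 1, HasDerivAt
      (fun w => l * ((1 - w) ^ (A + B - (C + 1)) * hypF A B (C + 1) w)) _ w := fun w hw =>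
    (hasDerivAt_one_sub_rpow_mul_hypF hA hB hC1 (habs w hw)).const_mul l
  have hmono1 : MonotoneOn (fun w => l * ((1 - w) ^ (A + B - (C + 1)) * hypF A B (C + 1) w))
      (Set.Ico 0 1) := by
    refine monotoneOn_of_deriv_nonneg (convex_Ico 0 1)
      (fun w hw => (hd1 w hw).continuousAt.continuousWithinAt)
      (fun w hw => (hd1 w (interior_subset hw)).differentiableAt.differentiableWithinAt)
      (fun w hw => ?_)
    have hw' := interior_subset hw
    rw [(hd1 w hw').deriv]
    have hF := hypF_nonneg hA hB (by positivity : 0 < C + 1 + 1) hw'.1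
    have hw1 : 0 ≤ 1 - w := by linarith [hw'.2]
    have hll : 0 ≤ l * ((C + 1 - A) * (C + 1 - B) / (C + 1)) := by
      rw [hl, div_mul_div_comm]
      exact div_nonneg hsign (by positivity)
    rw [← mul_assoc]
    exact mul_nonneg hll (mul_nonneg (Real.rpow_nonneg hw1 _) hF)
  have hd0 : ∀ w ∈ Set.Ico (0 : ℝ) 1, HasDerivAt
      (fun w => (1 - w) ^ (A + B - C) * hypF A B C w - l * w)
      (l * ((1 - w) ^ (A + B - (C + 1)) * hypF A B (C + 1) w) - l * 1) w := fun w hw =>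
    (hasDerivAt_one_sub_rpow_mul_hypF hA hB hC (habs w hw)).sub ((hasDerivAt_id w).const_mul l)
  have hmono0 : MonotoneOn (fun w => (1 - w) ^ (A + B - C) * hypF A B C w - l * w)
      (Set.Ico 0 1) := by
    refine monotoneOn_of_deriv_nonneg (convex_Ico 0 1)
      (fun w hw => (hd0 w hw).continuousAt.continuousWithinAt)
      (fun w hw => (hd0 w (interior_subset hw)).differentiableAt.differentiableWithinAt)
      (fun w hw => ?_)
    have hw' := interior_subset hw
    rw [(hd0 w hw').deriv]
    have h := hmono1 h0 hw' hw'.1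
    simp only [sub_zero, Real.one_rpow, hypF_zero] at h
    linarith
  have h := hmono0 h0 hz0 hz
  simp only [sub_zero, Real.one_rpow, hypF_zero, mul_zero] at h
  linarith

lemma integral_abs_rpow_mul_exp_neg_mul_sq {b s : ℝ} (hb : 0 < b) (hs : -1 < s) :
    ∫ x : ℝ, |x| ^ s * exp (-b * x ^ 2) = b ^ (-((s + 1) / 2)) * Gamma ((s + 1) / 2) := by
  have h := integral_comp_abs (f := fun x : ℝ => x ^ s * exp (-b * x ^ (2 : ℝ)))
  rw [integral_rpow_mul_exp_neg_mul_rpow two_pos hs hb] at h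
  simp only [rpow_two, sq_abs] at h
  rw [h, neg_div]
  ring

lemma integrable_abs_rpow_mul_exp_neg_mul_sq {b s : ℝ} (hb : 0 < b) (hs : -1 < s) :
    Integrable fun x : ℝ => |x| ^ s * exp (-b * x ^ 2) := by
  refine not_imp_comm.mp integral_undef ?_
  rw [integral_abs_rpow_mul_exp_neg_mul_sq hb hs]
  have := Gamma_pos_of_pos (by linarith : 0 < (s + 1) / 2)
  positivity

lemma abs_rpow_mul_pow_two_mul {s : ℝ} (hs : -1 < s) (x : ℝ) (n : ℕ) :
    |x| ^ s * x ^ (2 * n) = |x| ^ (s + 2 * n) := by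
  rcases n.eq_zero_or_pos with rfl | hn
  · simp
  · have hn' : (1 : ℝ) ≤ n := by exact_mod_cast hn
    have h := Real.rpow_add_natCast' (n := 2 * n) (abs_nonneg x) (y := s)
      (by push_cast; linarith)
    push_cast at h
    rw [h, (even_two_mul n).pow_abs]

lemma Gamma_mul_Gamma_add_nat {A B : ℝ} (hA : 0 < A) (hB : 0 < B) (n : ℕ) :
    Gamma (A + n) * Gamma (B + n) / (2 * n).factorial =
      Gamma A * Gamma B * hypCoeff A B (1 / 2) n / 4 ^ n := by
  induction n with
  | zero => simp [hypCoeff_zero]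
  | succ n ih =>
    have hA' : A + n ≠ 0 := by positivity
    have hB' : B + n ≠ 0 := by positivity
    rw [hypCoeff_succ, show 2 * (n + 1) = 2 * n + 1 + 1 by ring, Nat.factorial_succ,
      Nat.factorial_succ]
    push_cast
    rw [← add_assoc, ← add_assoc, Gamma_add_one hA', Gamma_add_one hB', pow_succ]
    calc _ = Gamma (A + n) * Gamma (B + n) / (2 * n).factorial *
          ((A + n) * (B + n) / ((2 * n + 1 + 1) * (2 * n + 1))) := by field_simp
      _ = _ := by
        rw [ih]
        field_simp
        ring

lemma integral_abs_rpow_mul_abs_rpow_mul_exp_mul_cosh {a b p q k : ℝ} (ha : -1 < a) (hb : -1 < b)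
    (hp : 0 < p) (hq : 0 < q) (hk : k ^ 2 < 4 * p * q) :
    ∫ w : ℝ × ℝ, (|w.1| ^ a * exp (-p * w.1 ^ 2)) * (|w.2| ^ b * exp (-q * w.2 ^ 2)) *
        cosh (k * w.1 * w.2) =
      p ^ (-((a + 1) / 2)) * q ^ (-((b + 1) / 2)) * (Gamma ((a + 1) / 2) * Gamma ((b + 1) / 2)) *
        hypF ((a + 1) / 2) ((b + 1) / 2) (1 / 2) (k ^ 2 / (4 * p * q)) := by
  set A := (a + 1) / 2 with hA_def
  set B := (b + 1) / 2 with hB_def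
  have hA : 0 < A := by rw [hA_def]; linarith
  have hB : 0 < B := by rw [hB_def]; linarith
  let T : ℕ → ℝ × ℝ → ℝ := fun n w => k ^ (2 * n) / (2 * n).factorial *
    ((|w.1| ^ (a + 2 * n) * exp (-p * w.1 ^ 2)) * (|w.2| ^ (b + 2 * n) * exp (-q * w.2 ^ 2)))
  have han : ∀ n : ℕ, -1 < a + 2 * n := fun n => by
    have : (0 : ℝ) ≤ n := n.cast_nonneg
    linarith
  have hbn : ∀ n : ℕ, -1 < b + 2 * n := fun n => by
    have : (0 : ℝ) ≤ n := n.cast_nonneg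
    linarith
  have hT_int : ∀ n, Integrable (T n) := fun n =>
    ((integrable_abs_rpow_mul_exp_neg_mul_sq hp (han n)).mul_prod
      (integrable_abs_rpow_mul_exp_neg_mul_sq hq (hbn n))).const_mul _
  have hT_nonneg : ∀ n w, 0 ≤ T n w := fun n w => by
    have := (even_two_mul n).pow_nonneg k
    positivity
  have hT_integral : ∀ n, ∫ w, T n w = p ^ (-A) * q ^ (-B) * (Gamma A * Gamma B) *
      (hypCoeff A B (1 / 2) n * (k ^ 2 / (4 * p * q)) ^ n) := fun n => by
    have hpn : p ^ (-(A + n)) = p ^ (-A) / p ^ n := by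
      rw [neg_add, ← sub_eq_add_neg, rpow_sub hp, rpow_natCast]
    have hqn : q ^ (-(B + n)) = q ^ (-B) / q ^ n := by
      rw [neg_add, ← sub_eq_add_neg, rpow_sub hq, rpow_natCast]
    have hprod := integral_prod_mul (μ := (volume : Measure ℝ)) (ν := (volume : Measure ℝ))
      (fun x : ℝ => |x| ^ (a + 2 * n) * exp (-p * x ^ 2))
      (fun y : ℝ => |y| ^ (b + 2 * n) * exp (-q * y ^ 2))
    rw [integral_abs_rpow_mul_exp_neg_mul_sq hp (han n),
      integral_abs_rpow_mul_exp_neg_mul_sq hq (hbn n),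
      show (a + 2 * n + 1) / 2 = A + n by rw [hA_def]; ring,
      show (b + 2 * n + 1) / 2 = B + n by rw [hB_def]; ring, hpn, hqn,
      ← Measure.volume_eq_prod] at hprod
    rw [integral_const_mul, hprod]
    calc _ = k ^ (2 * n) * (p ^ (-A) / p ^ n * (q ^ (-B) / q ^ n)) *
          (Gamma (A + n) * Gamma (B + n) / (2 * n).factorial) := by ring
      _ = _ := by
        rw [Gamma_mul_Gamma_add_nat hA hB, div_pow, mul_pow, mul_pow, pow_mul]
        field_simp
  have hz : |k ^ 2 / (4 * p * q)| < 1 := by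
    rw [abs_of_nonneg (by positivity), div_lt_one (by positivity)]
    exact hk
  have hsum := (summable_hypCoeff_mul_pow hA hB one_half_pos hz).mul_left
    (p ^ (-A) * q ^ (-B) * (Gamma A * Gamma B))
  have key := hasSum_integral_of_summable_integral_norm hT_int (by
    simp only [fun n w => Real.norm_of_nonneg (hT_nonneg n w), hT_integral]
    exact hsum)
  have hpt : ∀ w : ℝ × ℝ, ∑' n, T n w =
      (|w.1| ^ a * exp (-p * w.1 ^ 2)) * (|w.2| ^ b * exp (-q * w.2 ^ 2)) *
        cosh (k * w.1 * w.2) := fun w => by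
    rw [cosh_eq_tsum, ← tsum_mul_left]
    refine tsum_congr fun n => ?_
    simp only [T]
    rw [← abs_rpow_mul_pow_two_mul ha, ← abs_rpow_mul_pow_two_mul hb, mul_pow, mul_pow]
    ring
  simp only [hpt, hT_integral] at key
  rw [← key.tsum_eq, tsum_mul_left, hypF]

lemma integrable_abs_rpow_mul_abs_rpow_mul_exp_mul_exp {a b p q k : ℝ} (ha : -1 < a)
    (hb : -1 < b) (hp : 0 < p) (hq : 0 < q) (hk : k ^ 2 < 4 * p * q) :
    Integrable fun w : ℝ × ℝ => (|w.1| ^ a * exp (-p * w.1 ^ 2)) *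
      (|w.2| ^ b * exp (-q * w.2 ^ 2)) * exp (k * w.1 * w.2) := by
  have hF : 0 < ∫ w : ℝ × ℝ, (|w.1| ^ a * exp (-p * w.1 ^ 2)) *
      (|w.2| ^ b * exp (-q * w.2 ^ 2)) * cosh (k * w.1 * w.2) := by
    rw [integral_abs_rpow_mul_abs_rpow_mul_exp_mul_cosh ha hb hp hq hk]
    have hA : 0 < (a + 1) / 2 := by linarith
    have hB : 0 < (b + 1) / 2 := by linarith
    have hz : |k ^ 2 / (4 * p * q)| < 1 := by
      rw [abs_of_nonneg (by positivity), div_lt_one (by positivity)]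
      exact hk
    have h1 : 0 < hypF ((a + 1) / 2) ((b + 1) / 2) (1 / 2) (k ^ 2 / (4 * p * q)) :=
      (summable_hypCoeff_mul_pow hA hB one_half_pos hz).tsum_pos
        (fun n => mul_nonneg (hypCoeff_pos hA hB one_half_pos n).le (by positivity)) 0
        (by simp [hypCoeff_zero])
    have := Gamma_pos_of_pos hA
    have := Gamma_pos_of_pos hB
    positivity
  refine ((not_imp_comm.mp integral_undef hF.ne').const_mul 2).mono' ?_ ?_
  · exact Measurable.aestronglyMeasurable (by fun_prop)
  · refine Eventually.of_forall fun w => ?_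
    rw [Real.norm_of_nonneg (by positivity), cosh_eq]
    have h : exp (k * w.1 * w.2) ≤
        2 * ((exp (k * w.1 * w.2) + exp (-(k * w.1 * w.2))) / 2) := by
      linarith [exp_pos (-(k * w.1 * w.2))]
    calc _ ≤ (|w.1| ^ a * exp (-p * w.1 ^ 2)) * (|w.2| ^ b * exp (-q * w.2 ^ 2)) *
          (2 * ((exp (k * w.1 * w.2) + exp (-(k * w.1 * w.2))) / 2)) := by gcongr
      _ = _ := by ring

lemma integral_abs_rpow_mul_abs_rpow_mul_exp_mul_exp {a b p q k : ℝ} (ha : -1 < a) (hb : -1 < b)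
    (hp : 0 < p) (hq : 0 < q) (hk : k ^ 2 < 4 * p * q) :
    ∫ w : ℝ × ℝ, (|w.1| ^ a * exp (-p * w.1 ^ 2)) * (|w.2| ^ b * exp (-q * w.2 ^ 2)) *
        exp (k * w.1 * w.2) =
      p ^ (-((a + 1) / 2)) * q ^ (-((b + 1) / 2)) * (Gamma ((a + 1) / 2) * Gamma ((b + 1) / 2)) *
        hypF ((a + 1) / 2) ((b + 1) / 2) (1 / 2) (k ^ 2 / (4 * p * q)) := by
  rw [← integral_abs_rpow_mul_abs_rpow_mul_exp_mul_cosh ha hb hp hq hk]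
  have hi := integrable_abs_rpow_mul_abs_rpow_mul_exp_mul_exp ha hb hp hq hk
  have hi' := integrable_abs_rpow_mul_abs_rpow_mul_exp_mul_exp ha hb hp hq
    (by rwa [neg_sq] : (-k) ^ 2 < 4 * p * q)
  have hmp : MeasurePreserving (fun w : ℝ × ℝ => (-w.1, w.2)) volume volume :=
    (Measure.measurePreserving_neg (volume : Measure ℝ)).prod (MeasurePreserving.id volume)
  have hme : MeasurableEmbedding (fun w : ℝ × ℝ => (-w.1, w.2)) :=
    ((MeasurableEquiv.neg ℝ).prodCongr (MeasurableEquiv.refl ℝ)).measurableEmbedding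
  have hsymm := hmp.integral_comp hme (fun w : ℝ × ℝ => (|w.1| ^ a * exp (-p * w.1 ^ 2)) *
    (|w.2| ^ b * exp (-q * w.2 ^ 2)) * exp (k * w.1 * w.2))
  simp only [abs_neg, neg_sq, mul_neg] at hsymm
  simp only [neg_mul k] at hi'
  have hadd := integral_add hi hi'
  simp only [neg_mul] at hadd hsymm ⊢
  rw [hsymm] at hadd
  rw [eq_comm, ← mul_right_inj' (two_ne_zero (α := ℝ)), two_mul (∫ w : ℝ × ℝ, _ * exp _), ← hadd,
    ← integral_const_mul]
  refine integral_congr_ae (Eventually.of_forall fun w => ?_)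
  simp only [cosh_eq]
  ring

lemma inv_two_mul_mul_sq_rpow_neg {c σ : ℝ} (hc : 0 < c) (hσ : 0 < σ) (a : ℝ) :
    (2 * c * σ ^ 2)⁻¹ ^ (-((a + 1) / 2)) =
      2 ^ (a / 2) * √2 * c ^ ((a + 1) / 2) * (σ ^ a * σ) := by
  have h2 : (2 : ℝ) ^ ((a + 1) / 2) = 2 ^ (a / 2) * √2 := by
    rw [add_div, rpow_add two_pos, sqrt_eq_rpow]
  have hs : (σ ^ 2) ^ ((a + 1) / 2) = σ ^ a * σ := by
    rw [← rpow_add_one hσ.ne', ← rpow_natCast, ← rpow_mul hσ.le]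
    congr 1
    push_cast
    ring
  rw [inv_rpow (by positivity), rpow_neg (by positivity), inv_inv,
    mul_rpow (by positivity) (by positivity), mul_rpow two_pos.le hc.le, h2, hs]

lemma E1_eq {σ a : ℝ} (hσ : 0 < σ) (ha : -1 < a) :
    E1 σ a = 2 ^ (a / 2) * σ ^ a * Gamma ((a + 1) / 2) / √π := by
  have hint : ∀ x : ℝ, |x| ^ a * (√(2 * π * σ ^ 2))⁻¹ * exp (-x ^ 2 / (2 * σ ^ 2)) =
      (√(2 * π * σ ^ 2))⁻¹ * (|x| ^ a * exp (-(2 * 1 * σ ^ 2)⁻¹ * x ^ 2)) := fun x => by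
    rw [show -x ^ 2 / (2 * σ ^ 2) = -(2 * 1 * σ ^ 2)⁻¹ * x ^ 2 by ring]
    ring
  simp only [E1, hint]
  rw [integral_const_mul, integral_abs_rpow_mul_exp_neg_mul_sq (by positivity) ha,
    inv_two_mul_mul_sq_rpow_neg one_pos hσ, one_rpow, sqrt_mul (by positivity),
    sqrt_mul two_pos.le, sqrt_sq hσ.le]
  field_simp

lemma E2_eq {σ₁ σ₂ ρ a b : ℝ} (hσ₁ : 0 < σ₁) (hσ₂ : 0 < σ₂) (hρ : ρ ^ 2 < 1)
    (ha : -1 < a) (hb : -1 < b) :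
    E2 σ₁ σ₂ ρ a b = 2 ^ ((a + b) / 2) * σ₁ ^ a * σ₂ ^ b *
      (Gamma ((a + 1) / 2) * Gamma ((b + 1) / 2)) / π *
      ((1 - ρ ^ 2) ^ ((a + 1) / 2 + (b + 1) / 2 - 1 / 2) *
        hypF ((a + 1) / 2) ((b + 1) / 2) (1 / 2) (ρ ^ 2)) := by
  have hc : 0 < 1 - ρ ^ 2 := by linarith
  have hz : (ρ / ((1 - ρ ^ 2) * σ₁ * σ₂)) ^ 2 /
      (4 * (2 * (1 - ρ ^ 2) * σ₁ ^ 2)⁻¹ * (2 * (1 - ρ ^ 2) * σ₂ ^ 2)⁻¹) = ρ ^ 2 := by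
    field_simp
    norm_num
  have hint : ∀ w : ℝ × ℝ, |w.1| ^ a * |w.2| ^ b * gaussDensity2 σ₁ σ₂ ρ w.1 w.2 =
      (2 * π * σ₁ * σ₂ * √(1 - ρ ^ 2))⁻¹ *
        ((|w.1| ^ a * exp (-(2 * (1 - ρ ^ 2) * σ₁ ^ 2)⁻¹ * w.1 ^ 2)) *
          (|w.2| ^ b * exp (-(2 * (1 - ρ ^ 2) * σ₂ ^ 2)⁻¹ * w.2 ^ 2)) *
          exp (ρ / ((1 - ρ ^ 2) * σ₁ * σ₂) * w.1 * w.2)) := fun w => by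
    have hexp : -(w.1 ^ 2 / σ₁ ^ 2 - 2 * ρ * w.1 * w.2 / (σ₁ * σ₂) + w.2 ^ 2 / σ₂ ^ 2) /
        (2 * (1 - ρ ^ 2)) = -(2 * (1 - ρ ^ 2) * σ₁ ^ 2)⁻¹ * w.1 ^ 2 +
          -(2 * (1 - ρ ^ 2) * σ₂ ^ 2)⁻¹ * w.2 ^ 2 +
          ρ / ((1 - ρ ^ 2) * σ₁ * σ₂) * w.1 * w.2 := by
      field_simp
      ring
    rw [gaussDensity2, hexp, exp_add, exp_add]
    ring
  have hp : 0 < (2 * (1 - ρ ^ 2) * σ₁ ^ 2)⁻¹ := by positivity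
  have hq : 0 < (2 * (1 - ρ ^ 2) * σ₂ ^ 2)⁻¹ := by positivity
  simp only [E2, hint]
  rw [integral_const_mul, integral_abs_rpow_mul_abs_rpow_mul_exp_mul_exp ha hb hp hq
      ((div_lt_one (by positivity)).mp (hz.trans_lt hρ)), hz,
    inv_two_mul_mul_sq_rpow_neg hc hσ₁, inv_two_mul_mul_sq_rpow_neg hc hσ₂, rpow_sub hc,
    rpow_add hc, ← sqrt_eq_rpow, add_div a b, rpow_add two_pos]
  field_simp
  rw [sq_sqrt two_pos.le]

theorem gpi_quantitative_same_sign (σ₁ σ₂ ρ α₁ α₂ : ℝ)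
    (hσ₁ : 0 < σ₁) (hσ₂ : 0 < σ₂) (hρ : ρ ∈ Set.Ioo (-1 : ℝ) 1)
    (hα : (-1 < α₁ ∧ α₁ < 0 ∧ -1 < α₂ ∧ α₂ < 0) ∨
          (0 < α₁ ∧ α₁ ≤ 2 ∧ 0 < α₂ ∧ α₂ ≤ 2) ∨
          (2 < α₁ ∧ 2 < α₂)) :
    E2 σ₁ σ₂ ρ α₁ α₂ - E1 σ₁ α₁ * E1 σ₂ α₂ ≥
      2 ^ ((α₁ + α₂) / 2) * α₁ * α₂ * σ₁ ^ α₁ * σ₂ ^ α₂ * ρ ^ 2 / (2 * π) *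
        Real.Gamma ((α₁ + 1) / 2) * Real.Gamma ((α₂ + 1) / 2) := by
  have hρ2 : ρ ^ 2 < 1 := by nlinarith [hρ.1, hρ.2]
  have h₁ : -1 < α₁ := by rcases hα with h | h | h <;> linarith [h.1]
  have h₂ : -1 < α₂ := by
    rcases hα with h | h | h
    · exact h.2.2.1
    · linarith [h.2.2.1]
    · linarith [h.2]
  have hα_mul : 0 ≤ α₁ * α₂ := by
    rcases hα with h | h | h
    · exact mul_nonneg_of_nonpos_of_nonpos h.2.1.le h.2.2.2.le
    · exact mul_nonneg h.1.le h.2.2.1.le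
    · exact mul_nonneg (by linarith [h.1]) (by linarith [h.2])
  have hα_sub_mul : 0 ≤ (2 - α₁) * (2 - α₂) := by
    rcases hα with h | h | h
    · exact mul_nonneg (by linarith [h.2.1]) (by linarith [h.2.2.2])
    · exact mul_nonneg (by linarith [h.2.1]) (by linarith [h.2.2.2])
    · exact mul_nonneg_of_nonpos_of_nonpos (by linarith [h.1]) (by linarith [h.2])
  have hA : 0 < (α₁ + 1) / 2 := by linarith
  have hB : 0 < (α₂ + 1) / 2 := by linarith
  have key := one_add_mul_le_one_sub_rpow_mul_hypF hA hB one_half_pos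
    (by linarith [mul_nonneg hα_mul hα_sub_mul]) (sq_nonneg ρ) hρ2
  have hΓ₁ := Gamma_pos_of_pos hA
  have hΓ₂ := Gamma_pos_of_pos hB
  rw [E2_eq hσ₁ hσ₂ hρ2 h₁ h₂, E1_eq hσ₁ h₁, E1_eq hσ₂ h₂, ge_iff_le, le_sub_iff_add_le]
  refine le_trans (le_of_eq ?_) (mul_le_mul_of_nonneg_left key (by positivity))
  rw [div_mul_div_comm, mul_self_sqrt pi_pos.le, add_div α₁ α₂, rpow_add two_pos]
  field_simp
  ring
end

section
/- Let σ1, σ2 > 0 and ρ ∈ (−1,1). Then E[|X1|·|X2|] − E[|X1|]·E[|X2|] ≥ σ1 σ2 ρ² / π. -/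
open MeasureTheory Real

/-- Change of variables for the lower triangular linear map `(u, v) ↦ (a u, c u + d v)`. -/
lemma integral_comp_lowerTriangular {a c d : ℝ} (ha : a ≠ 0) (hd : d ≠ 0) (g : ℝ × ℝ → ℝ) :
    ∫ q, g q = ∫ q : ℝ × ℝ, |a * d| * g (a * q.1, c * q.1 + d * q.2) := by
  set L : ℝ × ℝ →L[ℝ] ℝ × ℝ := (Matrix.toLin (.finTwoProd ℝ) (.finTwoProd ℝ)
    !![a, 0; c, d]).toContinuousLinearMap with hL
  have hL_apply (q : ℝ × ℝ) : L q = (a * q.1, c * q.1 + d * q.2) := by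
    simp [hL, Matrix.toLin_finTwoProd_apply]
  have hdet : L.det = a * d := by
    simp [hL, LinearMap.det_toContinuousLinearMap, LinearMap.det_toLin]
  have hinj : Function.Injective L := by
    rintro ⟨u, v⟩ ⟨u', v'⟩ h
    simp only [hL_apply, Prod.mk.injEq] at h
    obtain rfl : u = u' := mul_left_cancel₀ ha h.1
    exact Prod.ext rfl (mul_left_cancel₀ hd (add_left_cancel h.2))
  have hsurj : Function.Surjective L := by
    rintro ⟨x, y⟩
    refine ⟨(x / a, (y - c * (x / a)) / d), ?_⟩
    rw [hL_apply]
    ext <;> dsimp only <;> field_simp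
    ring
  have key := integral_image_eq_integral_abs_det_fderiv_smul (volume : Measure (ℝ × ℝ))
    MeasurableSet.univ (fun q _ => L.hasFDerivAt.hasFDerivWithinAt (s := Set.univ) (x := q))
    hinj.injOn g
  rw [Set.image_univ, hsurj.range_eq] at key
  simpa only [Measure.restrict_univ, hdet, hL_apply, smul_eq_mul] using key

/-- The first absolute moment of a centered Gaussian. -/
lemma E1_one {σ : ℝ} (hσ : 0 < σ) : E1 σ 1 = σ * √(2 / π) := by
  have hexp (x : ℝ) : |x| ^ (1 : ℝ) * (√(2 * π * σ ^ 2))⁻¹ * rexp (-x ^ 2 / (2 * σ ^ 2)) =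
      (√(2 * π * σ ^ 2))⁻¹ *
        (|x| ^ (1 : ℝ) * rexp (-(1 / (2 * σ ^ 2)) * |x| ^ (2 : ℝ))) := by
    have harg : -x ^ 2 / (2 * σ ^ 2) = -(1 / (2 * σ ^ 2)) * |x| ^ (2 : ℝ) := by
      rw [rpow_two, sq_abs]
      ring
    rw [harg]
    ring
  have hint := integral_comp_abs
    (f := fun x : ℝ => x ^ (1 : ℝ) * rexp (-(1 / (2 * σ ^ 2)) * x ^ (2 : ℝ)))
  rw [integral_rpow_mul_exp_neg_mul_rpow two_pos (by norm_num) (by positivity)] at hint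
  unfold E1
  simp_rw [hexp]
  rw [integral_const_mul, hint]
  norm_num [rpow_neg_one]
  rw [sqrt_mul (by positivity), sqrt_mul two_pos.le, sqrt_sq hσ.le]
  field_simp
  exact (sq_sqrt two_pos.le).symm

/-- The radial integral. -/
lemma integral_cube_mul_exp_neg_half_sq :
    ∫ r in Set.Ioi (0 : ℝ), r ^ 3 * rexp (-r ^ 2 / 2) = 2 := by
  have h := integral_rpow_mul_exp_neg_mul_rpow (p := 2) (q := 3) (b := 1 / 2) two_pos
    (by norm_num) (by norm_num)
  have hΓ : Gamma 2 = 1 := by simp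
  have hpow : ((1 : ℝ) / 2) ^ (-2 : ℝ) = 4 := by
    rw [rpow_neg (by norm_num), rpow_two]
    norm_num
  norm_num only [hΓ, hpow] at h
  convert h using 4 with r
  · exact (rpow_natCast r 3).symm
  · rw [rpow_two]
    ring_nf

/-- The quadratic lower bound for the angular integral. -/
lemma one_add_half_sin_sq_le_cos_add_mul_sin {β : ℝ} (hβ : |β| ≤ π / 2) :
    1 + sin β ^ 2 / 2 ≤ cos β + β * sin β := by
  wlog h0 : 0 ≤ β generalizing β
  · simpa using this (β := -β) (by rwa [abs_neg]) (by linarith)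
  rw [abs_of_nonneg h0] at hβ
  have hder (t : ℝ) : HasDerivAt (fun t => cos t + t * sin t - sin t ^ 2 / 2)
      ((t - sin t) * cos t) t := by
    convert! ((hasDerivAt_cos t).add ((hasDerivAt_id t).mul (hasDerivAt_sin t))).sub
      (((hasDerivAt_sin t).pow 2).div_const 2) using 1
    simp
    ring
  have hmono : MonotoneOn (fun t => cos t + t * sin t - sin t ^ 2 / 2) (Set.Icc 0 (π / 2)) := by
    refine monotoneOn_of_deriv_nonneg (convex_Icc _ _) (by fun_prop)
      (fun t _ => (hder t).differentiableAt.differentiableWithinAt) fun t ht => ?_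
    rw [interior_Icc] at ht
    rw [(hder t).deriv]
    exact mul_nonneg (sub_nonneg.2 (sin_le ht.1.le))
      (cos_nonneg_of_mem_Icc ⟨by linarith [ht.1, pi_pos], ht.2.le⟩)
  have h := hmono ⟨le_rfl, by positivity⟩ ⟨h0, hβ⟩ h0
  simp at h
  linarith

/-- A lower bound for the angular integral (in fact an equality), obtained by choosing the sign
of `cos θ * sin (θ + β)` on each of the two halves of a period. -/
lemma le_integral_abs_cos_mul_sin (β : ℝ) (hβ : |β| ≤ π / 2) :
    2 * (cos β + β * sin β) ≤ ∫ θ in -π..π, |cos θ * sin (θ + β)| := by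
  obtain ⟨hβ₁, hβ₂⟩ := abs_le.1 hβ
  have hcont : Continuous fun θ => cos θ * sin (θ + β) := by fun_prop
  have hint (a b : ℝ) : IntervalIntegrable (fun θ => |cos θ * sin (θ + β)|) volume a b :=
    hcont.abs.intervalIntegrable a b
  have hper : Function.Periodic (fun θ => |cos θ * sin (θ + β)|) π := fun θ => by
    simp only [add_right_comm θ π β, cos_add_pi, sin_add_pi, neg_mul_neg]
  have hprim (a b : ℝ) : ∫ θ in a..b, cos θ * sin (θ + β) =
      (-cos (2 * b + β) / 4 + b * sin β / 2) - (-cos (2 * a + β) / 4 + a * sin β / 2) := by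
    refine intervalIntegral.integral_eq_sub_of_hasDerivAt
      (f := fun θ => -cos (2 * θ + β) / 4 + θ * sin β / 2) (fun θ _ => ?_)
      (hcont.intervalIntegrable a b)
    have hlin : HasDerivAt (fun θ : ℝ => 2 * θ + β) 2 θ := by
      simpa using ((hasDerivAt_id θ).const_mul 2).add_const β
    convert! (hlin.cos.neg.div_const 4).add
      (((hasDerivAt_id θ).mul_const (sin β)).div_const 2) using 1
    have h1 : sin (2 * θ + β) = sin (θ + β) * cos θ + cos (θ + β) * sin θ := by
      rw [← sin_add]; ring_nf
    have h2 : sin β = sin (θ + β) * cos θ - cos (θ + β) * sin θ := by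
      rw [← sin_sub]; ring_nf
    rw [h1, h2]
    ring
  have hleft : -∫ θ in (-(π / 2))..(-β), cos θ * sin (θ + β) ≤
      ∫ θ in (-(π / 2))..(-β), |cos θ * sin (θ + β)| := by
    rw [← intervalIntegral.integral_neg]
    exact intervalIntegral.integral_mono_on (by linarith) (hcont.neg.intervalIntegrable _ _)
      (hint _ _) fun θ _ => neg_le_abs _
  have hright : ∫ θ in (-β)..(π / 2), cos θ * sin (θ + β) ≤
      ∫ θ in (-β)..(π / 2), |cos θ * sin (θ + β)| :=
    intervalIntegral.integral_mono_on (by linarith) (hcont.intervalIntegrable _ _)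
      (hint _ _) fun θ _ => le_abs_self _
  have hsplit : ∫ θ in -π..π, |cos θ * sin (θ + β)| =
      2 * ∫ θ in (-(π / 2))..(π / 2), |cos θ * sin (θ + β)| := by
    have h1 := hper.intervalIntegral_add_eq (-π) (-(π / 2))
    have h2 := hper.intervalIntegral_add_eq 0 (-(π / 2))
    have hend : -(π / 2) + π = π / 2 := by ring
    rw [neg_add_cancel, hend] at h1
    rw [zero_add, hend] at h2
    rw [← intervalIntegral.integral_add_adjacent_intervals (hint (-π) 0) (hint 0 π), h1, h2]
    ring
  rw [hprim] at hleft hright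
  rw [hsplit, ← intervalIntegral.integral_add_adjacent_intervals (hint _ (-β)) (hint (-β) _)]
  have c1 : cos (2 * (π / 2) + β) = -cos β := by
    rw [show 2 * (π / 2) + β = β + π by ring, cos_add_pi]
  have c2 : cos (2 * -(π / 2) + β) = -cos β := by
    rw [show 2 * -(π / 2) + β = β - π by ring, cos_sub_pi]
  have c3 : cos (2 * -β + β) = cos β := by
    rw [show 2 * -β + β = -β by ring, cos_neg]
  rw [c2, c3] at hleft
  rw [c1, c3] at hright
  linarith

/-- Polar form of the mixed absolute moment with correlation `sin β`. -/
lemma E2_one_one_sin {σ₁ σ₂ β : ℝ} (hσ₁ : 0 < σ₁) (hσ₂ : 0 < σ₂) (hβ : 0 < cos β) :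
    E2 σ₁ σ₂ (sin β) 1 1 = σ₁ * σ₂ / π * ∫ θ in -π..π, |cos θ * sin (θ + β)| := by
  have hs : 1 - sin β ^ 2 = cos β ^ 2 := by linarith [sin_sq_add_cos_sq β]
  have hdens (u v : ℝ) : |σ₁ * (σ₂ * cos β)| *
      (|σ₁ * u| ^ (1 : ℝ) * |σ₂ * sin β * u + σ₂ * cos β * v| ^ (1 : ℝ) *
        gaussDensity2 σ₁ σ₂ (sin β) (σ₁ * u) (σ₂ * sin β * u + σ₂ * cos β * v)) =
      σ₁ * σ₂ / (2 * π) * (|u * (sin β * u + cos β * v)| * rexp (-(u ^ 2 + v ^ 2) / 2)) := by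
    have hy : σ₂ * sin β * u + σ₂ * cos β * v = σ₂ * (sin β * u + cos β * v) := by ring
    have harg : -((σ₁ * u) ^ 2 / σ₁ ^ 2 -
        2 * sin β * (σ₁ * u) * (σ₂ * (sin β * u + cos β * v)) / (σ₁ * σ₂) +
        (σ₂ * (sin β * u + cos β * v)) ^ 2 / σ₂ ^ 2) / (2 * cos β ^ 2) =
        -(u ^ 2 + v ^ 2) / 2 := by
      field_simp
      linear_combination (-u ^ 2) * hs
    unfold gaussDensity2
    rw [hy, hs, harg, sqrt_sq hβ.le, rpow_one, rpow_one, abs_mul σ₁ u, abs_mul σ₂,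
      abs_mul u, abs_of_pos hσ₁, abs_of_pos hσ₂, abs_of_pos (by positivity)]
    field_simp
  unfold E2
  rw [integral_comp_lowerTriangular (c := σ₂ * sin β) hσ₁.ne' (mul_pos hσ₂ hβ).ne']
  simp_rw [hdens]
  rw [integral_const_mul, ← integral_comp_polarCoord_symm]
  have hpolar : ∫ p in polarCoord.target, p.1 •
      (|(polarCoord.symm p).1 * (sin β * (polarCoord.symm p).1 +
        cos β * (polarCoord.symm p).2)| *
        rexp (-((polarCoord.symm p).1 ^ 2 + (polarCoord.symm p).2 ^ 2) / 2)) =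
      ∫ p in Set.Ioi (0 : ℝ) ×ˢ Set.Ioo (-π) π,
        (p.1 ^ 3 * rexp (-p.1 ^ 2 / 2)) * |cos p.2 * sin (p.2 + β)| := by
    refine setIntegral_congr_fun (measurableSet_Ioi.prod measurableSet_Ioo) fun p _ => ?_
    have h1 : (p.1 * cos p.2) * (sin β * (p.1 * cos p.2) + cos β * (p.1 * sin p.2)) =
        p.1 ^ 2 * (cos p.2 * sin (p.2 + β)) := by
      rw [sin_add]
      ring
    have h2 : (p.1 * cos p.2) ^ 2 + (p.1 * sin p.2) ^ 2 = p.1 ^ 2 := by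
      linear_combination p.1 ^ 2 * sin_sq_add_cos_sq p.2
    simp only [polarCoord_symm_apply, smul_eq_mul]
    rw [h1, h2, abs_mul, abs_of_nonneg (sq_nonneg p.1)]
    ring
  rw [hpolar, Measure.volume_eq_prod,
    setIntegral_prod_mul (fun r : ℝ => r ^ 3 * rexp (-r ^ 2 / 2))
      (fun θ => |cos θ * sin (θ + β)|), integral_cube_mul_exp_neg_half_sq,
    ← integral_Ioc_eq_integral_Ioo,
    ← intervalIntegral.integral_of_le (by linarith [pi_pos])]
  field_simp

theorem gpi_quantitative_abs_abs (σ₁ σ₂ ρ : ℝ)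
    (hσ₁ : 0 < σ₁) (hσ₂ : 0 < σ₂) (hρ : ρ ∈ Set.Ioo (-1 : ℝ) 1) :
    E2 σ₁ σ₂ ρ 1 1 - E1 σ₁ 1 * E1 σ₂ 1 ≥ σ₁ * σ₂ * ρ ^ 2 / π := by
  obtain ⟨β, hβ, hcos, rfl⟩ : ∃ β, |β| ≤ π / 2 ∧ 0 < cos β ∧ sin β = ρ :=
    ⟨arcsin ρ, abs_le.2 ⟨neg_pi_div_two_le_arcsin ρ, arcsin_le_pi_div_two ρ⟩,
      cos_pos_of_mem_Ioo ⟨neg_pi_div_two_lt_arcsin.2 hρ.1, arcsin_lt_pi_div_two.2 hρ.2⟩,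
      sin_arcsin hρ.1.le hρ.2.le⟩
  have hJ : 2 + sin β ^ 2 ≤ ∫ θ in -π..π, |cos θ * sin (θ + β)| := by
    linarith [le_integral_abs_cos_mul_sin β hβ, one_add_half_sin_sq_le_cos_add_mul_sin hβ]
  have hprod : σ₁ * √(2 / π) * (σ₂ * √(2 / π)) = σ₁ * σ₂ / π * 2 := by
    rw [mul_mul_mul_comm, mul_self_sqrt (by positivity)]
    ring
  rw [E2_one_one_sin hσ₁ hσ₂ hcos, E1_one hσ₁, E1_one hσ₂, hprod, ge_iff_le, ← mul_sub,
    mul_div_right_comm]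
  gcongr
  linarith
end

section
/- Let σ1, σ2 > 0, ρ ∈ (−1,1), and let m be an even integer with m > 2. Then E[|X1|^m · |X2|] − E[|X1|^m]·E[|X2|] ≥ (m−2)!! · m · σ1^m σ2 ρ² / √(2π), where (m−2)!! is the double factorial of m−2. -/
open MeasureTheory Real

open ProbabilityTheory
open scoped Nat

lemma integral_abs_rpow_gaussianReal {a : ℝ} (ha : -1 < a) :
    ∫ x, |x| ^ a ∂gaussianReal 0 1 = 2 ^ (a / 2) * Gamma ((a + 1) / 2) / √π := by
  have h : ∀ x : ℝ, gaussianPDFReal 0 1 x • |x| ^ a =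
      (√(2 * π))⁻¹ * (|x| ^ a * rexp (-(1 / 2) * |x| ^ (2 : ℝ))) := fun x ↦ by
    simp only [gaussianPDFReal, smul_eq_mul, NNReal.coe_one, rpow_two, sq_abs]
    ring_nf
  rw [integral_gaussianReal_eq_integral_smul one_ne_zero]
  simp_rw [h]
  rw [integral_const_mul, integral_comp_abs (f := fun x ↦ x ^ a * rexp (-(1 / 2) * x ^ (2 : ℝ))),
    integral_rpow_mul_exp_neg_mul_rpow two_pos ha (by norm_num), sqrt_mul two_pos.le,
    one_div, inv_rpow two_pos.le, ← rpow_neg two_pos.le, sqrt_eq_rpow 2,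
    show -(-(a + 1) / 2) = a / 2 + 1 / 2 by ring, rpow_add two_pos]
  have : (2 : ℝ) ^ (1 / 2 : ℝ) ≠ 0 := by positivity
  field_simp

lemma integral_abs_mul_pow_gaussianReal (k : ℕ) :
    ∫ x, |x| * x ^ (2 * k) ∂gaussianReal 0 1 = √(2 / π) * 2 ^ k * k ! := by
  have h : ∀ x : ℝ, |x| * x ^ (2 * k) = |x| ^ (2 * k + 1 : ℝ) := fun x ↦ by
    rw [pow_mul, ← sq_abs, ← pow_mul, ← pow_succ', ← rpow_natCast]
    push_cast; rfl
  simp_rw [h]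
  rw [integral_abs_rpow_gaussianReal (by linarith [k.cast_nonneg (α := ℝ)]),
    show (2 * k + 1 + 1 : ℝ) / 2 = k + 1 by ring, Gamma_nat_eq_factorial,
    show (2 * k + 1 : ℝ) / 2 = 1 / 2 + k by ring, rpow_add two_pos, ← sqrt_eq_rpow, rpow_natCast,
    sqrt_div two_pos.le]
  ring

lemma integral_pow_even_gaussianReal (j : ℕ) :
    ∫ x, x ^ (2 * j) ∂gaussianReal 0 1 = (2 * j)! / (2 ^ j * j !) := by
  have h : ∀ x : ℝ, x ^ (2 * j) = |x| ^ (2 * j : ℝ) := fun x ↦ by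
    rw [pow_mul, ← sq_abs, ← pow_mul, ← rpow_natCast]
    push_cast; rfl
  simp_rw [h]
  rw [integral_abs_rpow_gaussianReal (by linarith [j.cast_nonneg (α := ℝ)]),
    show (2 * j + 1 : ℝ) / 2 = j + 1 / 2 by ring, Gamma_nat_add_half,
    show (2 * j : ℝ) / 2 = j by ring, rpow_natCast, eq_div_iff (by positivity)]
  have h2 : ((2 * j)! : ℝ) = (2 * j - 1)‼ * (2 ^ j * j !) := by
    rw_mod_cast [← Nat.doubleFactorial_two_mul]
    cases j with
    | zero => simp
    | succ i =>
      rw [show 2 * (i + 1) = 2 * i + 1 + 1 by ring, Nat.factorial_eq_mul_doubleFactorial]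
      simp [mul_comm]
  rw [h2]
  field_simp

lemma integral_pow_odd_gaussianReal {j : ℕ} (hj : Odd j) :
    ∫ x, x ^ j ∂gaussianReal 0 1 = 0 := by
  have h := integral_map (μ := gaussianReal 0 1) (f := fun x : ℝ ↦ x ^ j)
    measurable_neg.aemeasurable (by fun_prop)
  rw [show (Neg.neg : ℝ → ℝ) = fun x ↦ -x from rfl, gaussianReal_map_neg] at h
  simp only [neg_zero, hj.neg_pow, integral_neg] at h
  linarith

lemma integrable_pow_gaussianReal (j : ℕ) : Integrable (fun x ↦ x ^ j) (gaussianReal 0 1) := by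
  have := (memLp_id_gaussianReal (μ := 0) (v := 1) (j : NNReal)).integrable_norm_pow'
  refine this.mono (by fun_prop) (by simp)

lemma integrable_abs_mul_pow_gaussianReal (j : ℕ) :
    Integrable (fun x ↦ |x| * x ^ j) (gaussianReal 0 1) :=
  (integrable_pow_gaussianReal (j + 1)).mono (by fun_prop) (by simp [pow_succ'])

lemma sum_range_even_of_odd_eq_zero (f : ℕ → ℝ) (hf : ∀ j, Odd j → f j = 0) (n : ℕ) :
    ∑ j ∈ Finset.range (2 * n + 1), f j = ∑ k ∈ Finset.range (n + 1), f (2 * k) := by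
  induction n with
  | zero => simp
  | succ n ih =>
    rw [show 2 * (n + 1) + 1 = 2 * n + 1 + 1 + 1 by ring, Finset.sum_range_succ,
      Finset.sum_range_succ, ih, Finset.sum_range_succ _ (n + 1), hf (2 * n + 1) (by simp)]
    simp [mul_add]


lemma E1_eq_rpow_mul_integral_gaussianReal {σ : ℝ} (hσ : 0 < σ) (a : ℝ) :
    E1 σ a = σ ^ a * ∫ x, |x| ^ a ∂gaussianReal 0 1 := by
  have h := Measure.integral_comp_mul_left
    (fun x : ℝ ↦ |x| ^ a * (√(2 * π * σ ^ 2))⁻¹ * rexp (-x ^ 2 / (2 * σ ^ 2))) σ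
  rw [abs_of_pos (inv_pos.2 hσ), smul_eq_mul, eq_inv_mul_iff_mul_eq₀ hσ.ne'] at h
  rw [E1, ← h, integral_gaussianReal_eq_integral_smul one_ne_zero, ← integral_const_mul,
    ← integral_const_mul]
  congr 1 with x
  rw [abs_mul, abs_of_pos hσ, mul_rpow hσ.le (abs_nonneg x), sqrt_mul (by positivity),
    sqrt_sq hσ.le, show -(σ * x) ^ 2 / (2 * σ ^ 2) = -x ^ 2 / 2 by field_simp]
  simp only [gaussianPDFReal, smul_eq_mul, NNReal.coe_one, sub_zero, mul_one]
  field_simp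

lemma integral_prod_eq_integral_comp_triangular (g : ℝ × ℝ → ℝ) {a d : ℝ} (b : ℝ)
    (ha : 0 < a) (hd : 0 < d) :
    ∫ q, g q = ∫ q : ℝ × ℝ, a * d * g (a * q.1 + b * q.2, d * q.2) := by
  let T : ℝ × ℝ →L[ℝ] ℝ × ℝ :=
    (Matrix.toLin (Module.Basis.finTwoProd ℝ) (Module.Basis.finTwoProd ℝ)
      !![a, b; 0, d]).toContinuousLinearMap
  have hT (q : ℝ × ℝ) : T q = (a * q.1 + b * q.2, d * q.2) := by
    simp [T, Matrix.toLin_finTwoProd_apply]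
  have hdet : T.det = a * d := by
    simp [T, LinearMap.det_toLin, ContinuousLinearMap.det]
  have hinj : Function.Injective T := by
    rintro ⟨x, y⟩ ⟨x', y'⟩ h
    simp only [hT, Prod.mk.injEq, mul_right_inj' hd.ne'] at h
    obtain ⟨h, rfl⟩ := h
    simpa [ha.ne'] using h
  have hsurj : Function.Surjective T := LinearMap.injective_iff_surjective.1 hinj
  have h := integral_image_eq_integral_abs_det_fderiv_smul volume MeasurableSet.univ
    (fun x _ ↦ T.hasFDerivWithinAt) hinj.injOn g
  rw [Set.image_univ, hsurj.range_eq, Measure.restrict_univ] at h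
  simpa only [hdet, hT, abs_of_pos (mul_pos ha hd), smul_eq_mul] using h

lemma gaussDensity2_triangular {σ₁ σ₂ ρ : ℝ} (hσ₁ : 0 < σ₁) (hσ₂ : 0 < σ₂)
    (hρ : ρ ∈ Set.Ioo (-1 : ℝ) 1) (z u : ℝ) :
    σ₁ * √(1 - ρ ^ 2) * σ₂ *
      gaussDensity2 σ₁ σ₂ ρ (σ₁ * √(1 - ρ ^ 2) * z + σ₁ * ρ * u) (σ₂ * u) =
      gaussianPDFReal 0 1 z * gaussianPDFReal 0 1 u := by
  have hs : 0 < 1 - ρ ^ 2 := by nlinarith [hρ.1, hρ.2]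
  have hs' := sq_sqrt hs.le
  have hpos := sqrt_pos.2 hs
  set s := √(1 - ρ ^ 2)
  have hexp : -((σ₁ * s * z + σ₁ * ρ * u) ^ 2 / σ₁ ^ 2 -
      2 * ρ * (σ₁ * s * z + σ₁ * ρ * u) * (σ₂ * u) / (σ₁ * σ₂) + (σ₂ * u) ^ 2 / σ₂ ^ 2) /
      (2 * (1 - ρ ^ 2)) = -z ^ 2 / 2 + -u ^ 2 / 2 := by
    rw [← hs']
    field_simp
    linear_combination u ^ 2 * hs'
  have hpi := mul_self_sqrt (show 0 ≤ 2 * π by positivity)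
  rw [gaussDensity2, hexp, exp_add]
  simp only [gaussianPDFReal, NNReal.coe_one, sub_zero, mul_one]
  rw [show (2 * π * σ₁ * σ₂ * s) = √(2 * π) * √(2 * π) * σ₁ * σ₂ * s by rw [hpi]]
  field_simp

lemma E2_even_one_eq_sum {σ₁ σ₂ ρ : ℝ} (hσ₁ : 0 < σ₁) (hσ₂ : 0 < σ₂)
    (hρ : ρ ∈ Set.Ioo (-1 : ℝ) 1) (n : ℕ) :
    E2 σ₁ σ₂ ρ (2 * n : ℕ) 1 = σ₁ ^ (2 * n) * σ₂ * √(2 / π) *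
      ∑ k ∈ Finset.range (n + 1), (ρ ^ 2) ^ k * (1 - ρ ^ 2) ^ (n - k) *
        ((2 * n).choose (2 * k) * (2 ^ k * k !) *
          ((2 * (n - k))! / (2 ^ (n - k) * (n - k)!))) := by
  have hs : 0 < 1 - ρ ^ 2 := by nlinarith [hρ.1, hρ.2]
  have hpos := sqrt_pos.2 hs
  have key (q : ℝ × ℝ) : σ₁ * √(1 - ρ ^ 2) * σ₂ *
      (|σ₁ * √(1 - ρ ^ 2) * q.1 + σ₁ * ρ * q.2| ^ ((2 * n : ℕ) : ℝ) * |σ₂ * q.2| ^ (1 : ℝ) *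
        gaussDensity2 σ₁ σ₂ ρ (σ₁ * √(1 - ρ ^ 2) * q.1 + σ₁ * ρ * q.2) (σ₂ * q.2)) =
      ∑ j ∈ Finset.range (2 * n + 1), σ₁ ^ (2 * n) * σ₂ *
        (ρ ^ j * √(1 - ρ ^ 2) ^ (2 * n - j) * (2 * n).choose j) *
        ((gaussianPDFReal 0 1 q.1 • q.1 ^ (2 * n - j)) *
          (gaussianPDFReal 0 1 q.2 • (|q.2| * q.2 ^ j))) := by
    have hd := gaussDensity2_triangular hσ₁ hσ₂ hρ q.1 q.2
    rw [rpow_natCast, rpow_one, (even_two_mul n).pow_abs, abs_mul, abs_of_pos hσ₂,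
      show σ₁ * √(1 - ρ ^ 2) * q.1 + σ₁ * ρ * q.2 = σ₁ * (ρ * q.2 + √(1 - ρ ^ 2) * q.1) by ring,
      mul_pow, add_pow]
    rw [show σ₁ * √(1 - ρ ^ 2) * q.1 + σ₁ * ρ * q.2 = σ₁ * (ρ * q.2 + √(1 - ρ ^ 2) * q.1) by ring]
      at hd
    rw [← mul_assoc, mul_right_comm (_ * _) _ (gaussDensity2 _ _ _ _ _), hd]
    simp only [Finset.mul_sum, Finset.sum_mul, mul_pow, smul_eq_mul]
    refine Finset.sum_congr rfl fun j _ ↦ ?_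
    ring
  have hint {f : ℝ → ℝ} (hf : Integrable f (gaussianReal 0 1)) :
      Integrable (fun x ↦ gaussianPDFReal 0 1 x • f x) := by
    rw [gaussianReal_of_var_ne_zero _ one_ne_zero,
      integrable_withDensity_iff_integrable_smul' (measurable_gaussianPDF 0 1)
        (ae_of_all _ fun _ ↦ gaussianPDF_lt_top)] at hf
    simpa only [toReal_gaussianPDF] using hf
  have hprod (i j : ℕ) : ∫ q : ℝ × ℝ, (gaussianPDFReal 0 1 q.1 • q.1 ^ i) *
      (gaussianPDFReal 0 1 q.2 • (|q.2| * q.2 ^ j)) ∂volume.prod volume =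
      (∫ x, x ^ i ∂gaussianReal 0 1) * ∫ x, |x| * x ^ j ∂gaussianReal 0 1 := by
    rw [integral_prod_mul (fun x : ℝ ↦ gaussianPDFReal 0 1 x • x ^ i)
      (fun x : ℝ ↦ gaussianPDFReal 0 1 x • (|x| * x ^ j)),
      integral_gaussianReal_eq_integral_smul one_ne_zero,
      integral_gaussianReal_eq_integral_smul one_ne_zero]
  rw [E2, integral_prod_eq_integral_comp_triangular _ (σ₁ * ρ) (mul_pos hσ₁ hpos) hσ₂]
  simp_rw [key, Measure.volume_eq_prod]
  rw [integral_finsetSum _ fun j _ ↦ ((hint (integrable_pow_gaussianReal _)).mul_prod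
    (hint (integrable_abs_mul_pow_gaussianReal j))).const_mul _]
  simp_rw [integral_const_mul, hprod]
  rw [sum_range_even_of_odd_eq_zero, Finset.mul_sum]
  · refine Finset.sum_congr rfl fun k hk ↦ ?_
    rw [← Nat.mul_sub, integral_pow_even_gaussianReal, integral_abs_mul_pow_gaussianReal,
      pow_mul ρ, pow_mul √(1 - ρ ^ 2), sq_sqrt hs.le]
    ring
  · intro j hj
    by_cases h : j ≤ 2 * n
    · rw [integral_pow_odd_gaussianReal (Nat.Even.sub_odd h (even_two_mul n) hj)]
      ring
    · simp [Nat.choose_eq_zero_of_lt (not_le.1 h)]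

/-- The ratio `4 ^ k / centralBinom k` divided by `k` is antitone in `k`. -/
lemma mul_four_pow_div_centralBinom_le {k n : ℕ} (hk : 0 < k) (hkn : k ≤ n) :
    (k : ℝ) * (4 ^ n / n.centralBinom) ≤ n * (4 ^ k / k.centralBinom) := by
  induction n, hkn using Nat.le_induction with
  | base => rfl
  | succ n hkn ih =>
    have hn : (0 : ℝ) < n := by exact_mod_cast hk.trans_le hkn
    have hc : (0 : ℝ) < n.centralBinom := by exact_mod_cast n.centralBinom_pos
    have hck : (0 : ℝ) < k.centralBinom := by exact_mod_cast k.centralBinom_pos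
    have hc' : ((n + 1).centralBinom : ℝ) = 2 * (2 * n + 1) * n.centralBinom / (n + 1) := by
      rw [eq_div_iff (by positivity), mul_comm]
      exact_mod_cast n.succ_mul_centralBinom_succ
    calc (k : ℝ) * (4 ^ (n + 1) / (n + 1).centralBinom)
        = (k * (4 ^ n / n.centralBinom)) * ((2 * n + 2) / (2 * n + 1)) := by
          rw [hc']; field_simp; ring
      _ ≤ (n * (4 ^ k / k.centralBinom)) * ((n + 1) / n) := by
          gcongr ?_ * ?_
          rw [div_le_div_iff₀ (by positivity) hn]
          nlinarith
      _ = _ := by push_cast; field_simp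

lemma two_mul_centralBinom_le_four_pow {k : ℕ} (hk : 0 < k) : 2 * k.centralBinom ≤ 4 ^ k := by
  induction k, hk using Nat.le_induction with
  | base => simp [Nat.centralBinom, Nat.choose]
  | succ k _ ih =>
    rw [pow_succ]
    nlinarith [k.succ_mul_centralBinom_succ, k.centralBinom_pos]

lemma mul_four_pow_div_centralBinom_div_two_le {k n : ℕ} (hkn : k ≤ n) :
    (k : ℝ) * (4 ^ n / n.centralBinom) / 2 ≤ n * (4 ^ k / k.centralBinom - 1) := by
  rcases k.eq_zero_or_pos with rfl | hk
  · simp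
  have h := mul_four_pow_div_centralBinom_le hk hkn
  have h3 : (2 : ℝ) ≤ 4 ^ k / k.centralBinom := by
    rw [le_div_iff₀ (by exact_mod_cast k.centralBinom_pos)]
    exact_mod_cast two_mul_centralBinom_le_four_pow hk
  nlinarith [n.cast_nonneg (α := ℝ)]

lemma choose_two_mul_mul_factorial_eq {k n : ℕ} (hkn : k ≤ n) :
    ((2 * n).choose (2 * k) : ℝ) * (2 ^ k * k !) * ((2 * (n - k))! / (2 ^ (n - k) * (n - k)!)) =
      (2 * n)! / (2 ^ n * n !) * (n.choose k * (4 ^ k / k.centralBinom)) := by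
  obtain ⟨d, rfl⟩ := Nat.exists_eq_add_of_le hkn
  rw [Nat.centralBinom, Nat.cast_choose ℝ (by lia : 2 * k ≤ 2 * (k + d)), Nat.cast_choose ℝ hkn,
    Nat.cast_choose ℝ (by lia : k ≤ 2 * k), ← Nat.mul_sub, Nat.add_sub_cancel_left,
    show 2 * k - k = k by lia, pow_add, show (4 : ℝ) = 2 * 2 by norm_num, mul_pow]
  field_simp

lemma one_add_le_sum_binomial_mul_four_pow_div_centralBinom {t : ℝ} (ht₀ : 0 ≤ t) (ht₁ : t ≤ 1)
    {n : ℕ} (hn : 0 < n) :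
    1 + t * (4 ^ n / n.centralBinom) / 2 ≤ ∑ k ∈ Finset.range (n + 1),
      t ^ k * (1 - t) ^ (n - k) * (n.choose k * (4 ^ k / k.centralBinom)) := by
  have hn' : (0 : ℝ) < n := by exact_mod_cast hn
  have hsum : ∑ k ∈ Finset.range (n + 1), t ^ k * (1 - t) ^ (n - k) * n.choose k = 1 := by
    rw [← add_pow]; simp
  have hmean : ∑ k ∈ Finset.range (n + 1), t ^ k * (1 - t) ^ (n - k) * n.choose k * k = n * t := by
    have h := congrArg (Polynomial.eval t) (bernsteinPolynomial.sum_smul ℝ n)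
    simp only [bernsteinPolynomial, Polynomial.eval_finsetSum, nsmul_eq_mul, Polynomial.eval_mul,
      Polynomial.eval_natCast, Polynomial.eval_pow, Polynomial.eval_X, Polynomial.eval_sub,
      Polynomial.eval_one] at h
    rw [← h]
    exact Finset.sum_congr rfl fun k _ ↦ by ring
  have hterm : ∑ k ∈ Finset.range (n + 1), t ^ k * (1 - t) ^ (n - k) * n.choose k *
      (n + k * (4 ^ n / n.centralBinom) / 2) ≤ ∑ k ∈ Finset.range (n + 1),
      n * (t ^ k * (1 - t) ^ (n - k) * (n.choose k * (4 ^ k / k.centralBinom))) := by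
    refine Finset.sum_le_sum fun k hk ↦ ?_
    have h := mul_four_pow_div_centralBinom_div_two_le (Finset.mem_range_succ_iff.1 hk)
    have h1 : 0 ≤ 1 - t := sub_nonneg.2 ht₁
    calc _ ≤ t ^ k * (1 - t) ^ (n - k) * n.choose k * (n * (4 ^ k / k.centralBinom)) := by
          gcongr; linarith
      _ = _ := by ring
  have hlhs : ∑ k ∈ Finset.range (n + 1), t ^ k * (1 - t) ^ (n - k) * n.choose k *
      (n + k * (4 ^ n / n.centralBinom) / 2) = n * (1 + t * (4 ^ n / n.centralBinom) / 2) := by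
    simp_rw [mul_add, Finset.sum_add_distrib, ← Finset.sum_mul, hsum, mul_div_assoc, ← mul_assoc,
      ← Finset.sum_mul, hmean]
    ring
  rw [hlhs, ← Finset.mul_sum] at hterm
  exact le_of_mul_le_mul_left hterm hn'

theorem gpi_quantitative_even_m_one (σ₁ σ₂ ρ : ℝ) (m : ℕ)
    (hσ₁ : 0 < σ₁) (hσ₂ : 0 < σ₂) (hρ : ρ ∈ Set.Ioo (-1 : ℝ) 1)
    (hm : 2 < m) (hmeven : Even m) :
    E2 σ₁ σ₂ ρ (m : ℝ) 1 - E1 σ₁ (m : ℝ) * E1 σ₂ 1 ≥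
      (Nat.doubleFactorial (m - 2) : ℝ) * m * σ₁ ^ (m : ℝ) * σ₂ * ρ ^ 2 /
        Real.sqrt (2 * π) := by
  obtain ⟨n, rfl⟩ := hmeven.exists_two_nsmul
  rw [smul_eq_mul] at *
  have hn : 0 < n := by lia
  have hfac : ((2 * n - 2)‼ : ℝ) * (2 * n : ℕ) = 2 ^ n * n ! := by
    rw_mod_cast [← Nat.doubleFactorial_two_mul]
    obtain ⟨i, rfl⟩ := Nat.exists_eq_succ_of_ne_zero hn.ne'
    rw [Nat.succ_eq_add_one, mul_add, Nat.add_sub_cancel, mul_one, Nat.doubleFactorial_add_two,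
      mul_comm]
  have hE1m : E1 σ₁ (2 * n : ℕ) = σ₁ ^ (2 * n) * ((2 * n)! / (2 ^ n * n !)) := by
    rw [E1_eq_rpow_mul_integral_gaussianReal hσ₁]
    simp_rw [rpow_natCast, (even_two_mul n).pow_abs, integral_pow_even_gaussianReal]
  have hE1 : E1 σ₂ 1 = σ₂ * √(2 / π) := by
    rw [E1_eq_rpow_mul_integral_gaussianReal hσ₂]
    simpa [hσ₂.ne'] using integral_abs_mul_pow_gaussianReal 0
  have hsqrt : (√(2 * π))⁻¹ = √(2 / π) / 2 := by
    rw [sqrt_mul two_pos.le, sqrt_div two_pos.le]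
    field_simp
    simp
  have hw : (2 * n)! / (2 ^ n * n !) * (4 ^ n / n.centralBinom : ℝ) = 2 ^ n * n ! := by
    simpa using (choose_two_mul_mul_factorial_eq (le_refl n)).symm
  have hsum := one_add_le_sum_binomial_mul_four_pow_div_centralBinom (sq_nonneg ρ)
    (by nlinarith [hρ.1, hρ.2] : ρ ^ 2 ≤ 1) hn
  have hE2 : E2 σ₁ σ₂ ρ (2 * n : ℕ) 1 = σ₁ ^ (2 * n) * σ₂ * √(2 / π) *
      ((2 * n)! / (2 ^ n * n !)) * ∑ k ∈ Finset.range (n + 1),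
        (ρ ^ 2) ^ k * (1 - ρ ^ 2) ^ (n - k) * (n.choose k * (4 ^ k / k.centralBinom)) := by
    rw [E2_even_one_eq_sum hσ₁ hσ₂ hρ, mul_assoc _ (_ / _), Finset.mul_sum (a := _ / _)]
    congr 1
    refine Finset.sum_congr rfl fun k hk ↦ ?_
    rw [choose_two_mul_mul_factorial_eq (Finset.mem_range_succ_iff.1 hk)]
    ring
  rw [hE2, hE1m, hE1, hfac.trans hw.symm, rpow_natCast, div_eq_mul_inv _ (√(2 * π)), hsqrt, ge_iff_le,
    le_sub_iff_add_le]
  refine le_trans (le_of_eq ?_) (mul_le_mul_of_nonneg_left hsum (by positivity))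
  ring
end

section
/- Let σ1, σ2 > 0, ρ ∈ (−1,1), and let m be an odd integer with m > 2. Then E[|X1|^m · |X2|] − E[|X1|^m]·E[|X2|] ≥ (m−2)!! · m · σ1^m σ2 ρ² / 2, where (m−2)!! is the double factorial of m−2. -/
open MeasureTheory Real

lemma integral_cos_pow_neg (n : ℕ) (θ : ℝ) :
    ∫ t in (0 : ℝ)..(-θ), cos t ^ n = -∫ t in (0 : ℝ)..θ, cos t ^ n := by
  have h := intervalIntegral.integral_comp_neg (a := 0) (b := θ) (fun t : ℝ => cos t ^ n)
  simp only [cos_neg, neg_zero] at h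
  rw [intervalIntegral.integral_symm, h]

lemma hasDerivAt_integral_cos_pow (n : ℕ) (θ : ℝ) :
    HasDerivAt (fun x => ∫ t in (0 : ℝ)..x, cos t ^ n) (cos θ ^ n) θ :=
  ((continuous_cos.pow n).integral_hasStrictDerivAt 0 θ).hasDerivAt

lemma sin_mul_integral_cos_pow_le (n : ℕ) {φ : ℝ} (h0 : 0 ≤ φ) (h1 : φ ≤ π / 2) :
    sin φ * ∫ t in (0 : ℝ)..(π / 2), cos t ^ (n + 1) ≤ ∫ t in (0 : ℝ)..φ, cos t ^ (n + 1) := by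
  have hint : ∀ m : ℕ, ∀ a b : ℝ, IntervalIntegrable (fun t => cos t ^ m) volume a b :=
    fun m a b => (continuous_cos.pow m).intervalIntegrable a b
  have hcint : ∀ a b : ℝ, IntervalIntegrable (fun t => cos φ ^ n * cos t) volume a b :=
    fun a b => (continuous_const.mul continuous_cos).intervalIntegrable a b
  have hcos : 0 ≤ cos φ := cos_nonneg_of_mem_Icc ⟨by linarith, h1⟩
  have hsin : 0 ≤ sin φ := sin_nonneg_of_nonneg_of_le_pi h0 (by linarith)
  have hlow : cos φ ^ n * sin φ ≤ ∫ t in (0 : ℝ)..φ, cos t ^ (n + 1) := by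
    calc cos φ ^ n * sin φ = ∫ t in (0 : ℝ)..φ, cos φ ^ n * cos t := by simp
      _ ≤ _ := by
        refine intervalIntegral.integral_mono_on h0 (hcint _ _) (hint _ _ _) fun t ht => ?_
        have ht' : cos φ ≤ cos t := cos_le_cos_of_nonneg_of_le_pi ht.1 (by linarith) ht.2
        rw [pow_succ]
        exact mul_le_mul_of_nonneg_right (pow_le_pow_left₀ hcos ht' n) (hcos.trans ht')
  have hhigh : ∫ t in φ..(π / 2), cos t ^ (n + 1) ≤ cos φ ^ n * (1 - sin φ) := by
    calc _ ≤ ∫ t in φ..(π / 2), cos φ ^ n * cos t := by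
          refine intervalIntegral.integral_mono_on h1 (hint _ _ _) (hcint _ _) fun t ht => ?_
          have ht' : cos t ≤ cos φ :=
            cos_le_cos_of_nonneg_of_le_pi h0 (by linarith [ht.2, pi_pos]) ht.1
          have ht0 : 0 ≤ cos t := cos_nonneg_of_mem_Icc ⟨by linarith [ht.1], ht.2⟩
          rw [pow_succ]
          exact mul_le_mul_of_nonneg_right (pow_le_pow_left₀ ht0 ht' n) ht0
      _ = _ := by simp
  rw [← intervalIntegral.integral_add_adjacent_intervals (hint _ 0 φ) (hint _ φ (π / 2))]
  nlinarith [sin_le_one φ, mul_le_mul_of_nonneg_left hhigh hsin,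
    mul_le_mul_of_nonneg_left hlow (sub_nonneg.2 (sin_le_one φ))]

/-- The quantitative one-dimensional inequality, in the angle `θ = arcsin ρ`. -/
lemma integral_cos_pow_quadratic_bound (n : ℕ) {θ : ℝ} (hθ : |θ| ≤ π / 2) :
    (∫ t in (0 : ℝ)..(π / 2), cos t ^ (n + 3)) * sin θ ^ 2 / 2 ≤
      sin θ * (∫ t in (0 : ℝ)..θ, cos t ^ (n + 3)) + cos θ ^ (n + 4) / (n + 3) - 1 / (n + 3) := by
  set W := ∫ t in (0 : ℝ)..(π / 2), cos t ^ (n + 3) with hW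
  have key : ∀ θ : ℝ, 0 ≤ θ → θ ≤ π / 2 → W * sin θ ^ 2 / 2 ≤
      sin θ * (∫ t in (0 : ℝ)..θ, cos t ^ (n + 3)) + cos θ ^ (n + 4) / (n + 3) - 1 / (n + 3) := by
    intro θ h0 h1
    let D : ℝ → ℝ := fun x => sin x * (∫ t in (0 : ℝ)..x, cos t ^ (n + 3)) +
      cos x ^ (n + 4) / (n + 3) - W * sin x ^ 2 / 2
    have hD : ∀ x, HasDerivAt D (cos x * (((n + 2 : ℝ) / (n + 3)) *
        ((∫ t in (0 : ℝ)..x, cos t ^ (n + 1)) -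
          sin x * ∫ t in (0 : ℝ)..(π / 2), cos t ^ (n + 1)))) x := by
      intro x
      have h := (((hasDerivAt_sin x).mul (hasDerivAt_integral_cos_pow (n + 3) x)).add
        (((hasDerivAt_cos x).pow (n + 4)).div_const ((n : ℝ) + 3))).sub
        ((((hasDerivAt_sin x).pow 2).const_mul W).div_const 2)
      refine h.congr_deriv ?_
      have e1 := integral_cos_pow (a := 0) (b := x) (n + 1)
      have e2 := integral_cos_pow (a := 0) (b := π / 2) (n + 1)
      simp only [cos_pi_div_two, sin_zero, mul_zero, sub_zero, ne_eq, Nat.add_eq_zero_iff,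
        one_ne_zero, and_false, not_false_eq_true, zero_pow, zero_mul, zero_div, zero_add] at e1 e2
      rw [hW, show n + 3 = n + 1 + 2 by ring, e1, e2]
      push_cast
      have : (n : ℝ) + 3 ≠ 0 := by positivity
      have h3 : (n : ℝ) + 1 + 2 ≠ 0 := by positivity
      field_simp
      ring
    have hmono : MonotoneOn D (Set.Icc 0 (π / 2)) := by
      refine monotoneOn_of_hasDerivWithinAt_nonneg (convex_Icc _ _)
        (fun x _ => (hD x).continuousAt.continuousWithinAt)
        (fun x _ => (hD x).hasDerivWithinAt) fun x hx => ?_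
      rw [interior_Icc] at hx
      refine mul_nonneg (cos_nonneg_of_mem_Icc ⟨by linarith [hx.1], hx.2.le⟩)
        (mul_nonneg (by positivity) ?_)
      exact sub_nonneg.2 (sin_mul_integral_cos_pow_le n hx.1.le hx.2.le)
    have := hmono ⟨le_rfl, by positivity⟩ ⟨h0, h1⟩ h0
    simp only [D, sin_zero, cos_zero, one_pow, zero_mul, zero_add, ne_eq, OfNat.ofNat_ne_zero,
      not_false_eq_true, zero_pow, mul_zero, zero_div, sub_zero] at this
    linarith
  rcases le_total 0 θ with h | h
  · exact key θ h ((le_abs_self θ).trans hθ)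
  · have := key (-θ) (by linarith) ((neg_le_abs θ).trans hθ)
    rw [integral_cos_pow_neg, sin_neg, cos_neg] at this
    simpa using this

lemma integral_cos_pow_even_mul_factorial (k : ℕ) :
    (∫ t in (0 : ℝ)..(π / 2), cos t ^ (2 * k)) * (2 ^ (k + 1) * k.factorial) =
      π * (Nat.doubleFactorial (2 * k - 1) : ℝ) := by
  induction k with
  | zero => simp
  | succ k ih =>
    have e := integral_cos_pow (a := 0) (b := π / 2) (2 * k)
    simp only [cos_pi_div_two, sin_zero, mul_zero, sub_zero, ne_eq, Nat.add_eq_zero_iff,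
      one_ne_zero, and_false, not_false_eq_true, zero_pow, zero_mul, zero_div, zero_add] at e
    have hd : Nat.doubleFactorial (2 * (k + 1) - 1) =
        (2 * k + 1) * Nat.doubleFactorial (2 * k - 1) := by
      cases k with
      | zero => rfl
      | succ j => exact Nat.doubleFactorial_add_two (2 * j + 1)
    rw [show 2 * (k + 1) = 2 * k + 2 by ring] at hd ⊢
    rw [e, hd, Nat.factorial_succ]
    push_cast
    have : (2 * (k : ℝ) + 2) ≠ 0 := by positivity
    field_simp
    linear_combination 2 * ih

lemma integral_abs_pow_mul_exp_neg_mul_sq (j : ℕ) {b : ℝ} (hb : 0 < b) :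
    ∫ x : ℝ, |x| ^ (2 * j + 1) * exp (-b * x ^ 2) = j.factorial / b ^ (j + 1) := by
  have h := integral_comp_abs (f := fun x : ℝ => x ^ (2 * j + 1) * exp (-b * x ^ 2))
  simp only [sq_abs] at h
  have h2 := integral_rpow_mul_exp_neg_mul_rpow (p := 2) (q := (2 * j + 1 : ℕ)) (b := b)
    (by norm_num) (by push_cast; linarith [(Nat.cast_nonneg j : (0 : ℝ) ≤ j)]) hb
  have e : (((2 * j + 1 : ℕ) : ℝ) + 1) / 2 = j + 1 := by push_cast; ring
  have e' : -(((2 * j + 1 : ℕ) : ℝ) + 1) / 2 = -((j + 1 : ℕ) : ℝ) := by push_cast; ring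
  rw [e, e', Gamma_nat_eq_factorial, rpow_neg hb.le, rpow_natCast] at h2
  simp only [rpow_natCast, rpow_two] at h2
  rw [h, h2]
  field_simp

lemma lintegral_abs_pow_mul_exp_neg_mul_sq (j : ℕ) {b : ℝ} (hb : 0 < b) :
    ∫⁻ x : ℝ, ENNReal.ofReal (|x| ^ (2 * j + 1) * exp (-b * x ^ 2)) =
      ENNReal.ofReal (j.factorial / b ^ (j + 1)) := by
  have h := integral_abs_pow_mul_exp_neg_mul_sq j hb
  rw [← h, ofReal_integral_eq_lintegral_ofReal]
  · refine not_imp_comm.1 integral_undef ?_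
    rw [h]
    positivity
  · exact Filter.Eventually.of_forall fun x => by positivity

lemma E1_odd {σ : ℝ} (hσ : 0 < σ) (j : ℕ) :
    E1 σ ((2 * j + 1 : ℕ) : ℝ) =
      j.factorial * (2 * σ ^ 2) ^ (j + 1) / (√(2 * π) * σ) := by
  have h := integral_abs_pow_mul_exp_neg_mul_sq j (b := (2 * σ ^ 2)⁻¹) (by positivity)
  rw [E1, show √(2 * π * σ ^ 2) = √(2 * π) * σ by
    rw [sqrt_mul (by positivity), sqrt_sq hσ.le]]
  calc _ = ∫ x : ℝ, (√(2 * π) * σ)⁻¹ *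
        (|x| ^ (2 * j + 1) * exp (-(2 * σ ^ 2)⁻¹ * x ^ 2)) := by
        refine integral_congr_ae (Filter.Eventually.of_forall fun x => ?_)
        simp only [rpow_natCast]
        rw [show -x ^ 2 / (2 * σ ^ 2) = -(2 * σ ^ 2)⁻¹ * x ^ 2 by ring]
        ring
    _ = _ := by
        rw [integral_const_mul, h, inv_pow, div_inv_eq_mul]
        ring

lemma lintegral_comp_affine (f : ℝ → ENNReal) {a : ℝ} (ha : a ≠ 0) (c : ℝ) :
    ∫⁻ y, f y = ∫⁻ u, ENNReal.ofReal |a| * f (a * u + c) := by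
  have himg : (fun u : ℝ => a * u + c) '' Set.univ = Set.univ := by
    rw [Set.image_univ, Set.range_eq_univ]
    exact fun y => ⟨(y - c) / a, by field_simp; ring⟩
  have h := lintegral_image_eq_lintegral_abs_deriv_mul (f := fun u : ℝ => a * u + c)
    (f' := fun _ => a) MeasurableSet.univ
    (fun u _ => by
      simpa using (((hasDerivAt_id u).const_mul a).add_const c).hasDerivWithinAt (s := Set.univ))
    (fun x _ y _ hxy => by simpa [ha] using hxy) f
  rwa [himg, setLIntegral_univ, setLIntegral_univ] at h

lemma gaussDensity2_affine {σ₁ σ₂ θ : ℝ} (hσ₁ : 0 < σ₁) (hσ₂ : 0 < σ₂) (hc : 0 < cos θ)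
    (x u : ℝ) :
    gaussDensity2 σ₁ σ₂ (sin θ) x (σ₂ * cos θ * x / σ₁ * u + σ₂ * sin θ * x / σ₁) =
      (2 * π * σ₁ * σ₂ * cos θ)⁻¹ * exp (-((1 + u ^ 2) / (2 * σ₁ ^ 2)) * x ^ 2) := by
  have hs : 1 - sin θ ^ 2 = cos θ ^ 2 := by rw [cos_sq']
  rw [gaussDensity2, hs, sqrt_sq hc.le]
  congr 2
  field_simp
  linear_combination (-x ^ 2) * hs

lemma E2_odd_one {σ₁ σ₂ θ : ℝ} (hσ₁ : 0 < σ₁) (hσ₂ : 0 < σ₂) (hc : 0 < cos θ) (k : ℕ) :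
    E2 σ₁ σ₂ (sin θ) ((2 * k + 1 : ℕ) : ℝ) 1 =
      σ₁ ^ (2 * k + 1) * σ₂ * (k + 1).factorial * 2 ^ (k + 1) / π *
        ∫ u : ℝ, |sin θ + cos θ * u| / (1 + u ^ 2) ^ (k + 2) := by
  have hmeas : Measurable fun q : ℝ × ℝ =>
      |q.1| ^ (2 * k + 1) * |q.2| * gaussDensity2 σ₁ σ₂ (sin θ) q.1 q.2 := by
    unfold gaussDensity2
    fun_prop
  have hdens : ∀ x y, 0 ≤ gaussDensity2 σ₁ σ₂ (sin θ) x y := fun x y => by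
    unfold gaussDensity2
    positivity
  set C := σ₁ ^ (2 * k + 1) * σ₂ * (k + 1).factorial * 2 ^ (k + 1) / π with hC
  set c := σ₂ / (2 * π * σ₁ ^ 3) with hcdef
  have hCpos : 0 ≤ C := by positivity
  rw [E2]
  simp only [rpow_natCast, rpow_one]
  rw [← integral_const_mul, integral_eq_lintegral_of_nonneg_ae
      (Filter.Eventually.of_forall fun q => mul_nonneg (by positivity) (hdens _ _))
      hmeas.aestronglyMeasurable,
    integral_eq_lintegral_of_nonneg_ae (Filter.Eventually.of_forall fun u => by positivity)
      (Measurable.aestronglyMeasurable (by fun_prop))]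
  congr 1
  rw [Measure.volume_eq_prod, lintegral_prod _ hmeas.ennreal_ofReal.aemeasurable]
  calc _ = ∫⁻ x : ℝ, ∫⁻ u : ℝ, ENNReal.ofReal (c * |sin θ + cos θ * u|) *
        ENNReal.ofReal (|x| ^ (2 * (k + 1) + 1) *
          exp (-((1 + u ^ 2) / (2 * σ₁ ^ 2)) * x ^ 2)) := by
        refine lintegral_congr_ae ?_
        filter_upwards [Measure.ae_ne volume (0 : ℝ)] with x hx
        rw [lintegral_comp_affine _ (a := σ₂ * cos θ * x / σ₁) (by positivity)
          (σ₂ * sin θ * x / σ₁)]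
        refine lintegral_congr fun u => ?_
        rw [gaussDensity2_affine hσ₁ hσ₂ hc, ← ENNReal.ofReal_mul (by positivity),
          ← ENNReal.ofReal_mul (by positivity)]
        congr 1
        have h1 : |σ₂ * cos θ * x / σ₁| = σ₂ * cos θ * |x| / σ₁ := by
          rw [abs_div, abs_mul, abs_mul, abs_of_pos hσ₁, abs_of_pos hσ₂, abs_of_pos hc]
        have h2 : |σ₂ * cos θ * x / σ₁ * u + σ₂ * sin θ * x / σ₁| =
            σ₂ * |x| / σ₁ * |sin θ + cos θ * u| := by
          rw [show σ₂ * cos θ * x / σ₁ * u + σ₂ * sin θ * x / σ₁ =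
            σ₂ * x / σ₁ * (sin θ + cos θ * u) by ring, abs_mul, abs_div, abs_mul,
            abs_of_pos hσ₁, abs_of_pos hσ₂]
        rw [h1, h2, hcdef]
        field_simp
        ring
    _ = ∫⁻ u : ℝ, ∫⁻ x : ℝ, ENNReal.ofReal (c * |sin θ + cos θ * u|) *
        ENNReal.ofReal (|x| ^ (2 * (k + 1) + 1) *
          exp (-((1 + u ^ 2) / (2 * σ₁ ^ 2)) * x ^ 2)) :=
        lintegral_lintegral_swap (by unfold Function.uncurry; fun_prop)
    _ = _ := by
        refine lintegral_congr fun u => ?_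
        rw [lintegral_const_mul _ (by fun_prop),
          lintegral_abs_pow_mul_exp_neg_mul_sq (k + 1) (by positivity),
          ← ENNReal.ofReal_mul (by positivity)]
        congr 1
        rw [hC, hcdef, div_pow]
        field_simp
        ring

lemma integral_Ioi_affine_div_one_add_sq_pow (k : ℕ) {θ : ℝ} (h0 : -(π / 2) < θ)
    (h1 : θ < π / 2) :
    IntegrableOn (fun u : ℝ => |sin θ + cos θ * u| / (1 + u ^ 2) ^ (k + 2)) (Set.Ioi (-tan θ)) ∧
    ∫ u in Set.Ioi (-tan θ), |sin θ + cos θ * u| / (1 + u ^ 2) ^ (k + 2) =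
      sin θ * (∫ t in (0 : ℝ)..(π / 2), cos t ^ (2 * k + 2)) +
      (sin θ * (∫ t in (0 : ℝ)..θ, cos t ^ (2 * k + 2)) + cos θ ^ (2 * k + 3) / (2 * k + 2)) := by
  have hc : 0 < cos θ := cos_pos_of_mem_Ioo ⟨h0, h1⟩
  have habs : Set.EqOn (fun u : ℝ => |sin θ + cos θ * u| / (1 + u ^ 2) ^ (k + 2))
      (fun u : ℝ => (sin θ + cos θ * u) / (1 + u ^ 2) ^ (k + 2)) (Set.Ioi (-tan θ)) := by
    intro u hu
    have : 0 ≤ sin θ + cos θ * u := by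
      have := mul_lt_mul_of_pos_left (Set.mem_Ioi.1 hu) hc
      rw [mul_neg, mul_comm, tan_mul_cos hc.ne'] at this
      linarith
    simp only [abs_of_nonneg this]
  have hpos : ∀ u ∈ Set.Ioi (-tan θ), 0 ≤ (sin θ + cos θ * u) / (1 + u ^ 2) ^ (k + 2) :=
    fun u hu => le_of_le_of_eq (by positivity) (habs hu)
  let P : ℝ → ℝ := fun u => sin θ * (∫ t in (0 : ℝ)..(arctan u), cos t ^ (2 * k + 2)) -
    cos θ / (2 * k + 2) * ((1 + u ^ 2) ^ (k + 1))⁻¹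
  have hP : ∀ u ∈ Set.Ici (-tan θ),
      HasDerivAt P ((sin θ + cos θ * u) / (1 + u ^ 2) ^ (k + 2)) u := by
    intro u _
    have hu : (1 + u ^ 2) ≠ 0 := by positivity
    have d1 := ((hasDerivAt_integral_cos_pow (2 * k + 2) (arctan u)).comp u
      (hasDerivAt_arctan u)).const_mul (sin θ)
    have d2 := (((((hasDerivAt_id u).pow 2).const_add 1).pow (k + 1)).inv
      (pow_ne_zero _ hu)).const_mul (cos θ / (2 * k + 2))
    refine (d1.sub d2).congr_deriv ?_
    rw [show 2 * k + 2 = 2 * (k + 1) by ring, pow_mul, cos_sq_arctan, div_pow, one_pow]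
    simp only [id, Pi.pow_apply, Nat.add_sub_cancel]
    push_cast
    have : (k : ℝ) + 1 ≠ 0 := by positivity
    have : 2 * (k : ℝ) + 2 ≠ 0 := by positivity
    field_simp
    ring
  have hlim : Filter.Tendsto P Filter.atTop
      (nhds (sin θ * (∫ t in (0 : ℝ)..(π / 2), cos t ^ (2 * k + 2)) -
        cos θ / (2 * k + 2) * 0)) := by
    refine Filter.Tendsto.sub (Filter.Tendsto.const_mul _ ?_) (Filter.Tendsto.const_mul _ ?_)
    · exact (hasDerivAt_integral_cos_pow (2 * k + 2) (π / 2)).continuousAt.tendsto.comp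
        (tendsto_nhds_of_tendsto_nhdsWithin tendsto_arctan_atTop)
    · refine Filter.Tendsto.inv_tendsto_atTop ((Filter.tendsto_pow_atTop (by omega)).comp ?_)
      exact Filter.tendsto_atTop_add_const_left _ _ (Filter.tendsto_pow_atTop (by norm_num))
  refine ⟨(integrableOn_congr_fun habs measurableSet_Ioi).2
    (integrableOn_Ioi_deriv_of_nonneg' hP hpos hlim), ?_⟩
  rw [setIntegral_congr_fun measurableSet_Ioi habs,
    integral_Ioi_of_hasDerivAt_of_nonneg' hP hpos hlim]
  simp only [P, arctan_neg, arctan_tan h0 h1, integral_cos_pow_neg, neg_sq]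
  rw [show 1 + tan θ ^ 2 = (cos θ ^ 2)⁻¹ by rw [← inv_one_add_tan_sq hc.ne', inv_inv]]
  rw [inv_pow, inv_inv]
  ring

lemma integral_abs_affine_div_one_add_sq_pow (k : ℕ) {θ : ℝ} (h0 : -(π / 2) < θ)
    (h1 : θ < π / 2) :
    ∫ u : ℝ, |sin θ + cos θ * u| / (1 + u ^ 2) ^ (k + 2) =
      2 * (sin θ * (∫ t in (0 : ℝ)..θ, cos t ^ (2 * k + 2)) +
        cos θ ^ (2 * k + 3) / (2 * k + 2)) := by
  obtain ⟨i1, e1⟩ := integral_Ioi_affine_div_one_add_sq_pow k h0 h1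
  obtain ⟨i2, e2⟩ := integral_Ioi_affine_div_one_add_sq_pow k (θ := -θ) (by linarith) (by linarith)
  have hneg : ∀ u : ℝ, |sin (-θ) + cos (-θ) * u| / (1 + u ^ 2) ^ (k + 2) =
      |sin θ + cos θ * (-u)| / (1 + (-u) ^ 2) ^ (k + 2) := by
    intro u
    rw [sin_neg, cos_neg, ← abs_neg, neg_sq]
    congr 2
    ring
  simp only [hneg] at i2 e2
  rw [tan_neg, neg_neg] at i2 e2
  rw [integral_comp_neg_Ioi (tan θ) (fun u => |sin θ + cos θ * u| / (1 + u ^ 2) ^ (k + 2)),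
    integral_cos_pow_neg, sin_neg, cos_neg] at e2
  have i3 : IntegrableOn (fun u : ℝ => |sin θ + cos θ * u| / (1 + u ^ 2) ^ (k + 2))
      (Set.Iic (-tan θ)) := by
    have i4 : IntegrableOn (fun u : ℝ => |sin θ + cos θ * (-u)| / (1 + (-u) ^ 2) ^ (k + 2))
        (Set.Ici (-(-tan θ))) := by
      rw [neg_neg]
      exact (integrableOn_Ici_iff_integrableOn_Ioi enorm_ne_top).2 i2
    have i5 := i4.comp_neg_Iic
    simpa only [neg_neg] using i5
  rw [← intervalIntegral.integral_Iic_add_Ioi i3 i1, e1, e2]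
  ring

theorem gpi_quantitative_odd_m_one (σ₁ σ₂ ρ : ℝ) (m : ℕ)
    (hσ₁ : 0 < σ₁) (hσ₂ : 0 < σ₂) (hρ : ρ ∈ Set.Ioo (-1 : ℝ) 1)
    (hm : 2 < m) (hmodd : Odd m) :
    E2 σ₁ σ₂ ρ (m : ℝ) 1 - E1 σ₁ (m : ℝ) * E1 σ₂ 1 ≥
      (Nat.doubleFactorial (m - 2) : ℝ) * m * σ₁ ^ (m : ℝ) * σ₂ * ρ ^ 2 / 2 := by
  obtain ⟨k, rfl⟩ := hmodd
  set θ := arcsin ρ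
  have hsin : sin θ = ρ := sin_arcsin hρ.1.le hρ.2.le
  have h0 : -(π / 2) < θ := neg_pi_div_two_lt_arcsin.2 hρ.1
  have h1 : θ < π / 2 := arcsin_lt_pi_div_two.2 hρ.2
  have hE1 := E1_odd hσ₂ 0
  simp only [mul_zero, zero_add, Nat.cast_one, Nat.factorial_zero, pow_one, one_mul] at hE1
  rw [← hsin, E2_odd_one hσ₁ hσ₂ (cos_pos_of_mem_Ioo ⟨h0, h1⟩) k,
    integral_abs_affine_div_one_add_sq_pow k h0 h1, E1_odd hσ₁ k, hE1, rpow_natCast]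
  have hB := integral_cos_pow_quadratic_bound (2 * k - 1) (abs_le.2 ⟨h0.le, h1.le⟩)
  have hW := integral_cos_pow_even_mul_factorial (k + 1)
  have hd : Nat.doubleFactorial (2 * (k + 1) - 1) =
      (2 * k + 1) * Nat.doubleFactorial (2 * k + 1 - 2) := by
    rw [show 2 * (k + 1) - 1 = (2 * k + 1 - 2) + 2 by omega, Nat.doubleFactorial_add_two]
    congr 1
    omega
  rw [hd, show 2 * (k + 1) = 2 * k + 2 by ring] at hW
  rw [show 2 * k - 1 + 3 = 2 * k + 2 by omega, show 2 * k - 1 + 4 = 2 * k + 3 by omega,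
    show ((2 * k - 1 : ℕ) : ℝ) + 3 = 2 * k + 2 by
      rw [Nat.cast_sub (by omega)]; push_cast; ring] at hB
  set W := ∫ t in (0 : ℝ)..(π / 2), cos t ^ (2 * k + 2)
  set A := ∫ t in (0 : ℝ)..θ, cos t ^ (2 * k + 2)
  set K := σ₁ ^ (2 * k + 1) * σ₂ * (k + 1).factorial * 2 ^ (k + 2) / π with hK
  have hKpos : 0 ≤ K := by positivity
  have hprod : k.factorial * (2 * σ₁ ^ 2) ^ (k + 1) / (√(2 * π) * σ₁) *
      (2 * σ₂ ^ 2 / (√(2 * π) * σ₂)) = K * (1 / (2 * k + 2)) := by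
    have hs : √(2 * π) ^ 2 = 2 * π := sq_sqrt (by positivity)
    rw [hK, Nat.factorial_succ]
    push_cast
    field_simp
    rw [hs]
    ring
  have hfin : K * W = (Nat.doubleFactorial (2 * k + 1 - 2) : ℝ) * (2 * k + 1 : ℕ) *
      σ₁ ^ (2 * k + 1) * σ₂ := by
    push_cast at hW ⊢
    rw [hK]
    field_simp
    linear_combination hW
  rw [hprod, ← hfin]
  have := mul_le_mul_of_nonneg_left hB hKpos
  have e : σ₁ ^ (2 * k + 1) * σ₂ * (k + 1).factorial * 2 ^ (k + 1) / π *
      (2 * (sin θ * A + cos θ ^ (2 * k + 3) / (2 * k + 2))) =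
      K * (sin θ * A + cos θ ^ (2 * k + 3) / (2 * k + 2)) := by
    rw [hK]
    ring
  rw [e]
  linarith
end
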